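/- arXiv:1302.0380 — 3 statements merged into one kernel-verified Lean document; each statement's English description precedes it below -/
import Mathlib

section
/- For every n ≥ 1, closed choice for subsets of the unit interval of cardinality exactly n+2 is not topologically Weihrauch reducible to convex choice in dimension n; that is, C_{[0,1],#=n+2} ≰_W XC_n. -/
/-! Framework: represented spaces, realizers, (strong) topological Weihrauch reducibility. -/

/-- Baire space ℕ^ℕ (with the product topology). -/
abbrev Baire : Type := ℕ → ℕ

/-- A standard pairing ⟨p, q⟩ on Baire space (interleaving). -/
def pairB (p q : Baire) : Baire := fun n => if n % 2 = 0 then p (n / 2) else q (n / 2)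

/-- A representation of `X`: the name relation of a partial map from Baire space to `X`
(`R p x` means that `p` is a name of `x`). -/
structure RepSp (X : Type*) where
  R : Baire → X → Prop

/-- Restriction of a representation to names in `A` (used for restrictions `f_A`). -/
def RepSp.restrict {X : Type*} (δ : RepSp X) (A : Set Baire) : RepSp X :=
  ⟨fun p x => δ.R p x ∧ p ∈ A⟩

/-- `F` is a realizer of the multivalued function `f` (whose domain is
`{x | (f x).Nonempty}`) with respect to the given representations. -/
def Realizes {X Y : Type*} (δX : RepSp X) (δY : RepSp Y) (f : X → Set Y)
    (F : Baire → Baire) : Prop :=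
  ∀ p x, δX.R p x → (f x).Nonempty → ∃ y ∈ f x, δY.R (F p) y

/-- Topological Weihrauch reducibility `f ≤_W g`: there are continuous partial functions
`H` (pre-processor) and `K` (post-processor) on Baire space such that
`p ↦ K⟨p, G (H p)⟩` realizes `f` for every realizer `G` of `g`. -/
def WRed {X Y U V : Type*} (δX : RepSp X) (δY : RepSp Y) (δU : RepSp U) (δV : RepSp V)
    (f : X → Set Y) (g : U → Set V) : Prop :=
  ∃ (H K : Baire → Baire) (dH dK : Set Baire), ContinuousOn H dH ∧ ContinuousOn K dK ∧
    ∀ G : Baire → Baire, Realizes δU δV g G →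
      ∀ p x, δX.R p x → (f x).Nonempty →
        p ∈ dH ∧ pairB p (G (H p)) ∈ dK ∧
          ∃ y ∈ f x, δY.R (K (pairB p (G (H p)))) y

/-- Strong topological Weihrauch reducibility `f ≤_sW g`:
`K ∘ G ∘ H` realizes `f` for every realizer `G` of `g`. -/
def SWRed {X Y U V : Type*} (δX : RepSp X) (δY : RepSp Y) (δU : RepSp U) (δV : RepSp V)
    (f : X → Set Y) (g : U → Set V) : Prop :=
  ∃ (H K : Baire → Baire) (dH dK : Set Baire), ContinuousOn H dH ∧ ContinuousOn K dK ∧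
    ∀ G : Baire → Baire, Realizes δU δV g G →
      ∀ p x, δX.R p x → (f x).Nonempty →
        p ∈ dH ∧ G (H p) ∈ dK ∧ ∃ y ∈ f x, δY.R (K (G (H p))) y

/-! Negative representation of closed subsets of a separable metric space with a
fixed dense sequence, Cauchy representation of points, and choice principles. -/

/-- An enumeration of the nonnegative rationals (as reals): `n ↦ a/(b+1)` with `(a,b)` = unpair. -/
noncomputable def ratCode (n : ℕ) : ℝ := (n.unpair.1 : ℝ) / ((n.unpair.2 : ℝ) + 1)

/-- The rational open ball of `X` coded by `n` (center from the dense sequence `α`,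
rational radius; radius `0` yields the empty ball, allowing padding). -/
noncomputable def ballCode {X : Type*} [MetricSpace X] (α : ℕ → X) (n : ℕ) : Set X :=
  Metric.ball (α n.unpair.1) (ratCode n.unpair.2)

/-- The negative representation `ψ₋` of closed sets: a name `p` enumerates rational open
balls and denotes `X` minus their union. -/
noncomputable def psiMinus {X : Type*} [MetricSpace X] (α : ℕ → X) (p : Baire) : Set X :=
  {x | ∀ i, x ∉ ballCode α (p i)}

/-- The represented space `A(X)` of closed subsets of `X` (negative information). -/
noncomputable def closedRep {X : Type*} [MetricSpace X] (α : ℕ → X) : RepSp (Set X) :=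
  ⟨fun p A => A = psiMinus α p⟩

/-- The Cauchy representation of points of `X` (w.r.t. the dense sequence `α`). -/
noncomputable def pointRep {X : Type*} [MetricSpace X] (α : ℕ → X) : RepSp X :=
  ⟨fun p x => ∀ i, dist x (α (p i)) < (2:ℝ)⁻¹ ^ i⟩

/-- Closed choice restricted to a class `𝔄` of sets: the multivalued map `A ↦ A` with
domain the nonempty members of `𝔄`. -/
def choiceFn {X : Type*} (𝔄 : Set (Set X)) : Set X → Set X :=
  fun A => {x | A ∈ 𝔄 ∧ x ∈ A}

/-- The class of (finite) sets of cardinality exactly `n`. -/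
def cardEqClass (X : Type*) (n : ℕ) : Set (Set X) := {A | A.Finite ∧ A.ncard = n}

/-- The class of nonempty (finite) sets of cardinality at most `n`. -/
def cardLeClass (X : Type*) (n : ℕ) : Set (Set X) :=
  {A | A.Finite ∧ A.Nonempty ∧ A.ncard ≤ n}

/-- The unit cube `[0,1]^n` inside `ℝ^n`. -/
def unitCube (n : ℕ) : Set (Fin n → ℝ) := Set.univ.pi fun _ => Set.Icc (0:ℝ) 1

/-- The class of nonempty closed convex subsets of the unit cube `[0,1]^n`. -/
def convexClass (n : ℕ) : Set (Set (Fin n → ℝ)) :=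
  {A | A.Nonempty ∧ IsClosed A ∧ Convex ℝ A ∧ A ⊆ unitCube n}

/-! Discrete spaces, Cantor space, products, composition, fractals. -/

/-- Cantor space `{0,1}^ℕ`, with the standard (first-difference) metric, whose topology
is the product topology. -/
noncomputable instance : MetricSpace (ℕ → Bool) := PiNat.metricSpace

/-- Representation of closed subsets of the discrete space `Fin k`:
a name enumerates the complement (`0` codes "nothing", `m+1` codes `m`). -/
def finSetRep (k : ℕ) : RepSp (Set (Fin k)) :=
  ⟨fun p A => A = {m : Fin k | ∀ i, p i ≠ (m : ℕ) + 1}⟩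

/-- Representation of points of the discrete space `Fin k`: `p` names `m` iff `p 0 = m`. -/
def finPointRep (k : ℕ) : RepSp (Fin k) := ⟨fun p m => p 0 = (m : ℕ)⟩

/-- Representation of closed subsets of the discrete space `ℕ`:
a name enumerates the complement (`0` codes "nothing", `m+1` codes `m`). -/
def natSetRep : RepSp (Set ℕ) := ⟨fun p A => A = {m : ℕ | ∀ i, p i ≠ m + 1}⟩

/-- Representation of points of the discrete space `ℕ`: `p` names `m` iff `p 0 = m`. -/
def natPointRep : RepSp ℕ := ⟨fun p m => p 0 = m⟩

/-- The `i`-th component of a name of an `n`-tuple (interleaving `n` streams). -/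
def projB (n : ℕ) (i : Fin n) (p : Baire) : Baire := fun k => p (k * n + i)

/-- Representation of `n`-tuples: a name codes `n` names, interleaved. -/
def piRep {X : Type*} (n : ℕ) (δ : RepSp X) : RepSp (Fin n → X) :=
  ⟨fun p x => ∀ i, δ.R (projB n i p) (x i)⟩

/-- The `n`-fold parallel product `f^n` of a multivalued function. -/
def piFn {X Y : Type*} (n : ℕ) (f : X → Set Y) : (Fin n → X) → Set (Fin n → Y) :=
  fun x => {y | ∀ i, y i ∈ f (x i)}

/-- Composition `g ∘ h` of multivalued functions: defined on those `t ∈ dom h` with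
`h t ⊆ dom g`, mapping `t` to `⋃ {g u | u ∈ h t}`. -/
def mcomp {T U V : Type*} (g : U → Set V) (h : T → Set U) : T → Set V :=
  fun t => {v | (h t).Nonempty ∧ (∀ u ∈ h t, (g u).Nonempty) ∧ ∃ u ∈ h t, v ∈ g u}

/-- `f` is a fractal: there is a multivalued `g` on a represented space with nonempty
carrier such that for every clopen `A` of Baire space the restriction `g_A` of `g` to
inputs with names in `A` is Weihrauch equivalent to `f`, or to the nowhere defined
function `0` (i.e. `g_A` has empty domain). -/
def Fractal {X Y : Type*} (δX : RepSp X) (δY : RepSp Y) (f : X → Set Y) : Prop :=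
  ∃ (Z W : Type) (δZ : RepSp Z) (δW : RepSp W) (g : Z → Set W), Nonempty Z ∧
    ∀ A : Set Baire, IsClopen A →
      (WRed (δZ.restrict A) δW δX δY g f ∧ WRed δX δY (δZ.restrict A) δW f g)
      ∨ ¬ ∃ p z, δZ.R p z ∧ p ∈ A ∧ (g z).Nonempty

/-- `f` is a closed fractal: as `Fractal`, with the witnessing representation total. -/
def ClosedFractal {X Y : Type*} (δX : RepSp X) (δY : RepSp Y) (f : X → Set Y) : Prop :=
  ∃ (Z W : Type) (δZ : RepSp Z) (δW : RepSp W) (g : Z → Set W), Nonempty Z ∧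
    (∀ p : Baire, ∃ z, δZ.R p z) ∧
    ∀ A : Set Baire, IsClopen A →
      (WRed (δZ.restrict A) δW δX δY g f ∧ WRed δX δY (δZ.restrict A) δW f g)
      ∨ ¬ ∃ p z, δZ.R p z ∧ p ∈ A ∧ (g z).Nonempty

/-- `X_ε(𝔄)`: the closure (in Baire space) of the set of `ψ₋`-names of sets `A ∈ 𝔄` such
that for every `x ∈ X` some `B ∈ 𝔄` satisfies `B ⊆ A \ B(x, ε)`. -/
noncomputable def Xeps {X : Type*} [MetricSpace X] (α : ℕ → X) (𝔄 : Set (Set X))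
    (ε : ℝ) : Set Baire :=
  closure {p | psiMinus α p ∈ 𝔄 ∧
    ∀ x : X, ∃ B ∈ 𝔄, B ⊆ psiMinus α p \ Metric.ball x ε}

/-- The represented space `ℝ_>`: a name is a nonincreasing sequence of rationals
converging to `x` (approximation from above). -/
noncomputable def gtRep : RepSp ℝ :=
  ⟨fun p x => (∀ i, ((Denumerable.ofNat ℚ (p (i+1)) : ℚ) : ℝ) ≤ ((Denumerable.ofNat ℚ (p i) : ℚ) : ℝ)) ∧
    Filter.Tendsto (fun i => ((Denumerable.ofNat ℚ (p i) : ℚ) : ℝ)) Filter.atTop (nhds x)⟩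

section CardinalityVersusConvexity

open Set Metric Filter Topology

/-- `p` and `s` have the same first `N` entries. -/
def AgreeBelow (N : ℕ) (p s : Baire) : Prop := ∀ i < N, p i = s i

theorem AgreeBelow.trans {M N : ℕ} {p q s : Baire} (h : AgreeBelow N p q) (h' : AgreeBelow M q s)
    (hMN : M ≤ N) : AgreeBelow M p s := fun i hi => (h i (hi.trans_le hMN)).trans (h' i hi)

theorem AgreeBelow.mono {M N : ℕ} {p q : Baire} (h : AgreeBelow N p q) (hMN : M ≤ N) :
    AgreeBelow M p q := fun i hi => h i (hi.trans_le hMN)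

theorem AgreeBelow.refl (N : ℕ) (p : Baire) : AgreeBelow N p p := fun _ _ => rfl

section Names

variable {X : Type*} [MetricSpace X]

/-- The open set of points that stay clear of the closures of the first `N` balls listed by `s`. -/
def room (α : ℕ → X) (s : Baire) (N : ℕ) : Set X :=
  {x | ∀ i < N, x ∉ closure (ballCode α (s i))}

theorem isOpen_room (α : ℕ → X) (s : Baire) (N : ℕ) : IsOpen (room α s N) := by
  have : room α s N = ⋂ i ∈ Finset.range N, (closure (ballCode α (s i)))ᶜ := by
    ext x; simp [room]
  rw [this]
  exact isOpen_biInter_finset fun i _ => isClosed_closure.isOpen_compl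

theorem AgreeBelow.room_eq {α : ℕ → X} {p s : Baire} {N : ℕ} (h : AgreeBelow N p s) :
    room α p N = room α s N := by
  ext x
  exact forall₂_congr fun i hi => by rw [h i hi]

theorem ballCode_zero (α : ℕ → X) : ballCode α 0 = ∅ := by
  simp [ballCode, ratCode]

theorem exists_ballCode_of_dist {α : ℕ → X} (hα : DenseRange α) (x : X) {δ : ℝ} (hδ : 0 < δ) :
    ∃ m, x ∈ ballCode α m ∧ closure (ballCode α m) ⊆ ball x δ := by
  obtain ⟨b, hb⟩ := exists_nat_one_div_lt (half_pos hδ)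
  have hb0 : (0 : ℝ) < 1 / ((b : ℝ) + 1) := by positivity
  obtain ⟨j, hj⟩ := hα.exists_dist_lt x hb0
  refine ⟨Nat.pair j (Nat.pair 1 b), ?_, ?_⟩
  · simpa [ballCode, ratCode] using hj
  · refine closure_ball_subset_closedBall.trans fun y hy => ?_
    simp only [ratCode, Nat.unpair_pair, mem_closedBall, Nat.cast_one] at hy
    have := dist_triangle y (α j) x
    rw [mem_ball]
    rw [dist_comm] at hj
    linarith

theorem exists_name {α : ℕ → X} (hα : DenseRange α) {A : Set X} (hA : A.Finite) {s : Baire} {N : ℕ}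
    (h : A ⊆ room α s N) :
    ∃ p, AgreeBelow N p s ∧ psiMinus α p = A ∧ ∀ M, A ⊆ room α p M := by
  classical
  let p : Baire := fun i => if i < N then s i else
    if Disjoint A (closure (ballCode α (i - N))) then i - N else 0
  have hp : ∀ i, ∀ x ∈ A, x ∉ closure (ballCode α (p i)) := by
    intro i x hx
    by_cases hi : i < N
    · simpa [p, hi] using h hx i hi
    · by_cases hd : Disjoint A (closure (ballCode α (i - N)))
      · simpa [p, hi, hd] using disjoint_left.1 hd hx
      · simp [p, hi, hd, ballCode_zero]
  refine ⟨p, fun i hi => by simp [p, hi], ?_, fun M x hx i _ => hp i x hx⟩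
  ext x
  refine ⟨fun hx => ?_, fun hx i hi => hp i x hx (subset_closure hi)⟩
  by_contra hxA
  obtain ⟨δ, hδ, hball⟩ := Metric.isOpen_iff.1 hA.isClosed.isOpen_compl x hxA
  obtain ⟨m, hm, hsub⟩ := exists_ballCode_of_dist hα x hδ
  have hd : Disjoint A (closure (ballCode α m)) :=
    disjoint_left.2 fun y hy hy' => hball (hsub hy') hy
  exact hx (m + N) (by simpa [p, hd] using hm)

/-- The names of sets of cardinality `m` inside `T` which agree with `s` below `N`. -/
def plays (α : ℕ → X) (m : ℕ) (s : Baire) (N : ℕ) (T : Set X) : Set Baire :=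
  {p | psiMinus α p ∈ cardEqClass X m ∧ AgreeBelow N p s ∧ psiMinus α p ⊆ T}

/-- A position: after the first `N` balls listed by `s`, there is still room for the
points of `F` and, apart from them, for the nonempty open set `V`. -/
structure Position (α : ℕ → X) (F : Finset X) (s : Baire) (N : ℕ) (V : Set X) : Prop where
  isOpen : IsOpen V
  nonempty : V.Nonempty
  subset_room : V ⊆ room α s N
  points_subset_room : ↑F ⊆ room α s N
  disjoint : Disjoint (F : Set X) V

theorem Position.exists_play [∀ x : X, (𝓝[≠] x).NeBot] {α : ℕ → X} (hα : DenseRange α)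
    {F : Finset X} {s : Baire} {N : ℕ} {V : Set X} (h : Position α F s N V) (j : ℕ) :
    ∃ (B : Finset X) (p : Baire), B.card = j ∧ ↑B ⊆ V ∧ psiMinus α p = ↑F ∪ ↑B ∧
      p ∈ plays α (F.card + j) s N (↑F ∪ V) ∧ ∀ M, ↑F ∪ ↑B ⊆ room α p M := by
  classical
  obtain ⟨x, hx⟩ := h.nonempty
  have hinf : V.Infinite := infinite_of_mem_nhds x (h.isOpen.mem_nhds hx)
  obtain ⟨B, hBV, hB⟩ := hinf.exists_subset_card_eq j
  obtain ⟨p, hps, hp, hroom⟩ := exists_name hα (A := ↑F ∪ ↑B)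
    (F.finite_toSet.union B.finite_toSet)
    (union_subset h.points_subset_room (hBV.trans h.subset_room))
  refine ⟨B, p, hB, hBV, hp, ⟨⟨?_, ?_⟩, hps, ?_⟩, hroom⟩
  · rw [hp]; exact F.finite_toSet.union B.finite_toSet
  · rw [hp, ← Finset.coe_union, ncard_coe_finset, Finset.card_union_of_disjoint, hB]
    exact Finset.disjoint_coe.1 (h.disjoint.mono_right hBV)
  · rw [hp]; exact union_subset_union_right _ hBV

theorem plays_subset {α : ℕ → X} {m : ℕ} {s s' : Baire} {N N' : ℕ} {T T' : Set X}
    (hs : AgreeBelow N s' s) (hN : N ≤ N') (hT : T' ⊆ T) :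
    plays α m s' N' T' ⊆ plays α m s N T :=
  fun _ hp => ⟨hp.1, hp.2.1.trans hs hN, hp.2.2.trans hT⟩

theorem exists_separation {A : Set X} (hA : A.Finite) :
    ∃ δ > 0, ∀ a ∈ A, ∀ b ∈ A, a ≠ b → δ ≤ dist a b := by
  by_cases h : A.Nontrivial
  · exact ⟨A.infsep, (hA.infsep_pos_iff_nontrivial).2 h,
      fun a ha b hb hab => infsep_le_dist_of_mem ha hb hab⟩
  · exact ⟨1, one_pos, fun a ha b hb hab => (hab (not_nontrivial_iff.1 h ha hb)).elim⟩

end Names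

section Avoidance

variable {X : Type*} [MetricSpace X] {n : ℕ}

/-- An assignment of closed convex sets `C p` to names `p` of `m`-point sets, upper semicontinuous
in `p`, together with a labelling of the points of `C p` by points of the set named by `p` that is
stable under small perturbations. -/
structure LabelledConvex (α : ℕ → X) (m n : ℕ) where
  C : Baire → Set (Fin n → ℝ)
  Lab : Baire → (Fin n → ℝ) → X → Prop
  convex : ∀ p, Convex ℝ (C p)
  isClosed : ∀ p, IsClosed (C p)
  usc : ∀ p, psiMinus α p ∈ cardEqClass X m → ∀ Q O, IsCompact Q → IsOpen O → C p ∩ Q ⊆ O →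
    ∃ N, ∀ p', psiMinus α p' ∈ cardEqClass X m → AgreeBelow N p' p → C p' ∩ Q ⊆ O
  mem_of_lab : ∀ p, psiMinus α p ∈ cardEqClass X m → ∀ x ∈ C p, ∀ y, Lab p x y → y ∈ psiMinus α p
  exists_lab : ∀ p, psiMinus α p ∈ cardEqClass X m → ∀ x ∈ C p, ∃ y, Lab p x y
  lab_stable : ∀ p, psiMinus α p ∈ cardEqClass X m → ∀ x ∈ C p, ∀ y, Lab p x y → ∀ ε > 0,
    ∃ N, ∃ r > 0, ∀ p', psiMinus α p' ∈ cardEqClass X m → AgreeBelow N p' p →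
      ∀ x' ∈ C p' ∩ ball x r, ∃ y', Lab p' x' y' ∧ dist y' y < ε

/-- Compact convex sets that vary in fewer than `k` coordinates. -/
def FlatBelow (k : ℕ) (Q : Set (Fin n → ℝ)) : Prop :=
  IsCompact Q ∧ Convex ℝ Q ∧
    (Q.Nonempty → ∃ S : Finset (Fin n), S.card < k ∧ ∀ x ∈ Q, ∀ y ∈ Q, ∀ i ∉ S, x i = y i)

theorem FlatBelow.slice {k : ℕ} {Q : Set (Fin n → ℝ)} (hQ : IsCompact Q) (hconv : Convex ℝ Q)
    {S : Finset (Fin n)} (hS : S.card < k + 1)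
    (hflat : ∀ x ∈ Q, ∀ y ∈ Q, ∀ i ∉ S, x i = y i) {i : Fin n} (hi : i ∈ S) (z : Fin n → ℝ)
    (ρ : ℝ) : FlatBelow k (Q ∩ {v | v i = z i} ∩ closedBall z ρ) := by
  refine ⟨?_, ?_, fun _ => ⟨S.erase i, ?_, ?_⟩⟩
  · have hcl : IsClosed {v : Fin n → ℝ | v i = z i} :=
      isClosed_eq (continuous_apply i) continuous_const
    exact (hQ.inter_right hcl).inter_right isClosed_closedBall
  · refine (hconv.inter ?_).inter (convex_closedBall z ρ)
    intro x hx y hy a b _ _ hab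
    simp only [mem_ofPred_eq] at hx hy
    simp only [mem_ofPred_eq, Pi.add_apply, Pi.smul_apply, hx, hy, ← add_smul, hab, one_smul]
  · rw [Finset.card_erase_of_mem hi]
    have := Finset.card_pos.2 ⟨i, hi⟩
    omega
  · intro x hx y hy j hj
    by_cases hji : j = i
    · subst hji; exact hx.1.2.trans hy.1.2.symm
    · exact hflat x hx.1.1 y hy.1.1 j fun h => hj (Finset.mem_erase.2 ⟨hji, h⟩)

/-- A finite net of coordinate slices separates far away points of a convex set. -/
theorem exists_slice_mem {Q : Set (Fin n → ℝ)} {S : Finset (Fin n)}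
    (hflat : ∀ x ∈ Q, ∀ y ∈ Q, ∀ i ∉ S, x i = y i) {Z : Set (Fin n → ℝ)} {r : ℝ} (hr : 0 < r)
    (hZ : Q ⊆ ⋃ z ∈ Z, ball z (r / 8)) {K : Set (Fin n → ℝ)} (hK : Convex ℝ K) (hKQ : K ⊆ Q)
    {x y : Fin n → ℝ} (hx : x ∈ K) (hy : y ∈ K) (hxy : r ≤ dist y x) :
    ∃ i ∈ S, ∃ z ∈ Z, (K ∩ {v | v i = z i} ∩ closedBall z (r / 2)).Nonempty ∧
      closedBall z (r / 2) ⊆ ball x r := by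
  have hpos : 0 < dist y x := hr.trans_le hxy
  obtain ⟨i, hi⟩ : ∃ i, |y i - x i| = dist y x := by
    have hne : (Finset.univ : Finset (Fin n)).Nonempty := by
      by_contra h
      have hn : IsEmpty (Fin n) := Finset.univ_eq_empty_iff.1 (Finset.not_nonempty_iff_eq_empty.1 h)
      rw [Subsingleton.elim y x, dist_self] at hpos
      exact hpos.false
    obtain ⟨i, -, hi⟩ := Finset.exists_max_image Finset.univ (fun i => dist (y i) (x i)) hne
    refine ⟨i, le_antisymm (dist_le_pi_dist y x i) ?_⟩
    exact (dist_pi_le_iff (abs_nonneg _)).2 fun j => hi j (Finset.mem_univ j)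
  have hiS : i ∈ S := by
    by_contra h
    rw [hflat y (hKQ hy) x (hKQ hx) i h, sub_self, abs_zero] at hi
    exact hpos.ne hi
  set d := dist y x with hd
  have hline : ∀ t : ℝ, 0 ≤ t → dist (AffineMap.lineMap x y t) x = t * d := fun t ht => by
    rw [dist_lineMap_left, Real.norm_of_nonneg ht, dist_comm, hd]
  have hcoord : ∀ t : ℝ, AffineMap.lineMap x y t i = x i + t * (y i - x i) := fun t => by
    simp [AffineMap.lineMap_apply, add_comm]
  have hmem : ∀ t ∈ Icc (0 : ℝ) 1, AffineMap.lineMap x y t ∈ K := fun t ht =>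
    hK.lineMap_mem hx hy ht
  set t₀ := r / 8 / d with ht₀
  have ht₀d : t₀ * d = r / 8 := by rw [ht₀]; field_simp
  have ht₀0 : 0 < t₀ := by positivity
  have ht₀1 : t₀ ≤ 1 := by rw [ht₀, div_le_one hpos]; linarith
  set u := AffineMap.lineMap x y t₀ with hu
  obtain ⟨z, hzZ, hz⟩ := mem_iUnion₂.1 (hZ (hKQ (hmem t₀ ⟨ht₀0.le, ht₀1⟩)))
  have hux : dist u x = r / 8 := by rw [hu, hline t₀ ht₀0.le, ht₀d]
  have huz : |u i - z i| < r / 8 := (dist_le_pi_dist u z i).trans_lt hz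
  have hne : y i - x i ≠ 0 := fun h => by rw [h, abs_zero] at hi; exact hpos.ne hi
  set t := (z i - x i) / (y i - x i) with ht
  have htmul : t * (y i - x i) = z i - x i := by rw [ht]; field_simp
  have hui : u i = x i + t₀ * (y i - x i) := hcoord t₀
  have htt : |t₀ - t| * d < r / 8 := by
    rw [← hi, ← abs_mul, sub_mul, htmul]
    have : t₀ * (y i - x i) - (z i - x i) = u i - z i := by rw [hui]; ring
    rw [this]; exact huz
  have htt' : |t₀ - t| < t₀ := by
    rw [← ht₀d] at htt
    exact lt_of_mul_lt_mul_right htt hpos.le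
  obtain ⟨h1, h2⟩ := abs_lt.1 htt'
  have ht0 : 0 ≤ t := by linarith
  have htd : t * d < r / 4 := by nlinarith
  have ht1 : t ≤ 1 := by
    by_contra h
    push Not at h
    nlinarith
  have hv : dist (AffineMap.lineMap x y t) x < r / 4 := by rwa [hline t ht0]
  have hzx : dist z x < r / 4 := by
    have := dist_triangle_left z x u
    rw [mem_ball] at hz
    linarith
  refine ⟨i, hiS, z, hzZ, ⟨AffineMap.lineMap x y t, ⟨hmem t ⟨ht0, ht1⟩, ?_⟩, ?_⟩, fun w hw => ?_⟩
  · simp only [mem_ofPred_eq]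
    rw [hcoord, htmul]; ring
  · have := dist_triangle_right (AffineMap.lineMap x y t) z x
    rw [mem_closedBall]; linarith
  · have := dist_triangle w z x
    rw [mem_closedBall] at hw
    rw [mem_ball]; linarith

variable {α : ℕ → X} {m : ℕ}

/-- Near a name `p`, the labels are near those at `p`, uniformly over a compact set. -/
theorem LabelledConvex.exists_uniform (L : LabelledConvex α m n) {p : Baire}
    (hp : psiMinus α p ∈ cardEqClass X m) {Q : Set (Fin n → ℝ)} (hQ : IsCompact Q) {B : Set X}
    (hB : B.Nonempty) (hlab : ∀ x ∈ Q ∩ L.C p, ∃ y ∈ B, L.Lab p x y) {ε : ℝ} (hε : 0 < ε) :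
    ∃ N, ∃ r > 0, ∀ x ∈ Q, ∃ y ∈ B, ∀ p', psiMinus α p' ∈ cardEqClass X m → AgreeBelow N p' p →
      ∀ x' ∈ L.C p' ∩ ball x r, ∃ y', L.Lab p' x' y' ∧ dist y' y < ε := by
  obtain ⟨y₀, hy₀⟩ := hB
  have : Nonempty X := ⟨y₀⟩
  have hloc : ∀ x ∈ Q, ∃ y ∈ B, ∃ N, ∃ r > 0, ∀ p', psiMinus α p' ∈ cardEqClass X m →
      AgreeBelow N p' p → ∀ x' ∈ L.C p' ∩ ball x r, ∃ y', L.Lab p' x' y' ∧ dist y' y < ε := by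
    intro x hx
    by_cases hxC : x ∈ L.C p
    · obtain ⟨y, hyB, hy⟩ := hlab x ⟨hx, hxC⟩
      exact ⟨y, hyB, L.lab_stable p hp x hxC y hy ε hε⟩
    · obtain ⟨r, hr, hball⟩ := nhds_basis_closedBall.mem_iff.1
        ((L.isClosed p).isOpen_compl.mem_nhds hxC)
      obtain ⟨N, hN⟩ := L.usc p hp (closedBall x r) ∅ (isCompact_closedBall x r) isOpen_empty
        fun z hz => hball hz.2 hz.1
      exact ⟨y₀, hy₀, N, r, hr, fun p' hp' hag x' hx' =>
        (hN p' hp' hag ⟨hx'.1, ball_subset_closedBall hx'.2⟩).elim⟩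
  choose! y hyB N r hr h using hloc
  obtain ⟨t, htQ, hcov⟩ := hQ.elim_nhds_subcover (fun x => ball x (r x))
    fun x hx => ball_mem_nhds x (hr x hx)
  obtain ⟨ρ, hρ, hleb⟩ := lebesgue_number_lemma_of_metric (c := fun i : t => ball i.1 (r i)) hQ
    (fun _ => isOpen_ball) (by simpa [iUnion_subtype] using hcov)
  refine ⟨t.sup N, ρ, hρ, fun x hx => ?_⟩
  obtain ⟨⟨i, hi⟩, hsub⟩ := hleb x hx
  exact ⟨y i, hyB i (htQ i hi), fun p' hp' hag x' hx' =>
    h i (htQ i hi) p' hp' (hag.mono (Finset.le_sup hi)) x' ⟨hx'.1, hsub hx'.2⟩⟩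

/-- In every play from the position, the points of `Q` are labelled by points of `V`. -/
def LabelledConvex.Commits (L : LabelledConvex α m n) (F : Finset X) (s : Baire) (N : ℕ)
    (V : Set X) (Q : Set (Fin n → ℝ)) : Prop :=
  ∀ p ∈ plays α m s N (↑F ∪ V), ∀ x ∈ Q ∩ L.C p, ∃ y ∈ V, L.Lab p x y

/-- In every play from the position, the convex set avoids `Q`. -/
def LabelledConvex.Avoids (L : LabelledConvex α m n) (F : Finset X) (s : Baire) (N : ℕ)
    (V : Set X) (Q : Set (Fin n → ℝ)) : Prop :=
  ∀ p ∈ plays α m s N (↑F ∪ V), Q ∩ L.C p = ∅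

/-- From every position committed for `Q`, one can reach a position avoiding `Q`. -/
def LabelledConvex.Avoidable (L : LabelledConvex α m n) (F : Finset X)
    (Q : Set (Fin n → ℝ)) : Prop :=
  ∀ s N V, Position α F s N V → L.Commits F s N V Q → ∃ s' N' V', Position α F s' N' V' ∧
    N ≤ N' ∧ AgreeBelow N s' s ∧ V' ⊆ V ∧ L.Avoids F s' N' V' Q

theorem LabelledConvex.Commits.mono {L : LabelledConvex α m n} {F : Finset X} {s s' : Baire}
    {N N' : ℕ} {V V' : Set X} {Q : Set (Fin n → ℝ)} (h : L.Commits F s N V Q)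
    (hpos : Position α F s N V) (hN : N ≤ N') (hs : AgreeBelow N s' s) (hV : V' ⊆ V) :
    L.Commits F s' N' V' Q := by
  intro p hp x hx
  obtain ⟨y, hy, hlab⟩ := h p (plays_subset hs hN (union_subset_union_right _ hV) hp) x hx
  refine ⟨y, ?_, hlab⟩
  exact (hp.2.2 (L.mem_of_lab p hp.1 x hx.2 y hlab)).resolve_left
    fun hF => disjoint_left.1 hpos.disjoint hF hy

theorem LabelledConvex.avoids_finite {ι : Type*} {L : LabelledConvex α m n} {F : Finset X}
    (P : Finset ι) (Q : ι → Set (Fin n → ℝ)) (h : ∀ a ∈ P, L.Avoidable F (Q a)) {s : Baire} {N : ℕ}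
    {V : Set X} (hpos : Position α F s N V) (hc : ∀ a ∈ P, L.Commits F s N V (Q a)) :
    ∃ s' N' V', Position α F s' N' V' ∧ N ≤ N' ∧ AgreeBelow N s' s ∧ V' ⊆ V ∧
      ∀ a ∈ P, L.Avoids F s' N' V' (Q a) := by
  classical
  induction P using Finset.induction_on with
  | empty => exact ⟨s, N, V, hpos, le_rfl, AgreeBelow.refl _ _, subset_rfl, by simp⟩
  | insert a P _ ih =>
    obtain ⟨s₁, N₁, V₁, hpos₁, hN₁, hs₁, hV₁, hav₁⟩ := ih
      (fun b hb => h b (Finset.mem_insert_of_mem hb)) fun b hb => hc b (Finset.mem_insert_of_mem hb)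
    have ha := Finset.mem_insert_self a P
    obtain ⟨s₂, N₂, V₂, hpos₂, hN₂, hs₂, hV₂, hav₂⟩ := h a ha s₁ N₁ V₁ hpos₁
      ((hc a ha).mono hpos hN₁ hs₁ hV₁)
    refine ⟨s₂, N₂, V₂, hpos₂, hN₁.trans hN₂, hs₂.trans hs₁ hN₁, hV₂.trans hV₁, fun b hb => ?_⟩
    rcases Finset.mem_insert.1 hb with rfl | hb
    · exact hav₂
    · exact fun p hp => hav₁ b hb p
        (plays_subset hs₂ hN₂ (union_subset_union_right _ hV₂) hp)

/-- If the part of `C p` in `Q` lies where all labels are in `W`, then removing `W` from the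
position makes `C` avoid `Q`. -/
theorem LabelledConvex.exists_avoids_of_labels {L : LabelledConvex α m n} {F : Finset X}
    {p : Baire} (hp : psiMinus α p ∈ cardEqClass X m) {Q O : Set (Fin n → ℝ)} (hQ : IsCompact Q)
    (hO : IsOpen O) (hCO : L.C p ∩ Q ⊆ O) {N : ℕ} {V W : Set X}
    (hlab : ∀ p', psiMinus α p' ∈ cardEqClass X m → AgreeBelow N p' p → ∀ x ∈ L.C p' ∩ O,
      ∃ y, L.Lab p' x y ∧ y ∈ W)
    (hV : IsOpen V) (hne : ∃ v ∈ V, ∀ M, v ∈ room α p M) (hF : ∀ M, ↑F ⊆ room α p M)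
    (hdisj : Disjoint ↑F V) (hW : Disjoint (↑F ∪ V) W) :
    ∃ N' V', Position α F p N' V' ∧ N ≤ N' ∧ V' ⊆ V ∧ L.Avoids F p N' V' Q := by
  obtain ⟨M, hM⟩ := L.usc p hp Q O hQ hO hCO
  obtain ⟨v, hvV, hv⟩ := hne
  refine ⟨max N M, V ∩ room α p (max N M), ⟨hV.inter (isOpen_room _ _ _), ⟨v, hvV, hv _⟩,
    inter_subset_right, hF _, hdisj.mono_right inter_subset_left⟩, le_max_left _ _,
    inter_subset_left, fun p' hp' => ?_⟩
  refine eq_empty_of_forall_notMem fun x hx => ?_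
  have hxO := hM p' hp'.1 (hp'.2.1.mono (le_max_right _ _)) ⟨hx.2, hx.1⟩
  obtain ⟨y, hy, hyW⟩ := hlab p' hp'.1 (hp'.2.1.mono (le_max_left _ _)) x ⟨hx.2, hxO⟩
  exact disjoint_left.1 hW (union_subset_union_right _ inter_subset_left
    (hp'.2.2 (L.mem_of_lab p' hp'.1 x hx.2 y hy))) hyW

theorem LabelledConvex.avoidable_of_flatBelow [∀ x : X, (𝓝[≠] x).NeBot] (hα : DenseRange α)
    (L : LabelledConvex α m n) (k : ℕ) :
    ∀ (Q : Set (Fin n → ℝ)) (F : Finset X), FlatBelow k Q → F.card + k + 1 = m →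
      L.Avoidable F Q := by
  classical
  induction k with
  | zero =>
    rintro Q F ⟨-, -, hQ⟩ - s N V hpos -
    have : Q = ∅ := not_nonempty_iff_eq_empty.1 fun h => by
      obtain ⟨S, hS, -⟩ := hQ h; omega
    exact ⟨s, N, V, hpos, le_rfl, AgreeBelow.refl _ _, subset_rfl, fun p _ => by simp [this]⟩
  | succ k ih =>
    rintro Q F ⟨hQ, hQconv, hflat⟩ hcard s N V hpos hcom
    rcases Q.eq_empty_or_nonempty with rfl | hQne
    · exact ⟨s, N, V, hpos, le_rfl, AgreeBelow.refl _ _, subset_rfl, fun p _ => by simp⟩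
    obtain ⟨S, hS, hSflat⟩ := hflat hQne
    obtain ⟨B, p, hBcard, hBV, hpA, hplay, hroom⟩ := hpos.exists_play hα (k + 2)
    rw [show F.card + (k + 2) = m by omega] at hplay
    obtain ⟨δ, hδ, hsep⟩ := exists_separation (F.finite_toSet.union B.finite_toSet)
    obtain ⟨c₀, hc₀, c₁, hc₁, hne⟩ := Finset.one_lt_card.1 (show 1 < B.card by omega)
    have hB₀ : c₀ ∈ (↑F ∪ ↑B : Set X) := Or.inr hc₀
    have hB₁ : c₁ ∈ (↑F ∪ ↑B : Set X) := Or.inr hc₁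
    have hFB : ∀ b ∈ B, b ∉ F := fun b hb hF => disjoint_left.1 hpos.disjoint hF (hBV hb)
    obtain ⟨N₀, r, hr, huni⟩ := L.exists_uniform hplay.1 hQ (B := (B : Set X)) ⟨c₀, hc₀⟩
      (fun x hx => by
        obtain ⟨y, hyV, hy⟩ := hcom p hplay x hx
        refine ⟨y, ?_, hy⟩
        have hyA := L.mem_of_lab p hplay.1 x hx.2 y hy
        rw [hpA] at hyA
        exact hyA.resolve_left fun hF => disjoint_left.1 hpos.disjoint hF hyV)
      (show 0 < δ / 4 by positivity)
    have : Nonempty X := ⟨c₀⟩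
    choose! l hlB hl using huni
    set N₁ := max N N₀ with hN₁
    set F₁ := insert c₀ F with hF₁
    set V₁ := V ∩ room α p N₁ ∩ ball c₁ (δ / 4) with hV₁
    have hF₁sub : (F₁ : Set X) ⊆ ↑F ∪ ↑B := by
      rw [hF₁, Finset.coe_insert]
      exact insert_subset hB₀ subset_union_left
    have hF₁far : ∀ y ∈ F₁, y ∉ ball c₁ (δ / 4) := by
      intro y hy hyb
      have hyc : y ≠ c₁ := by
        rintro rfl
        rcases Finset.mem_insert.1 hy with h | h
        · exact hne h.symm
        · exact hFB _ hc₁ h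
      have := hsep y (hF₁sub hy) c₁ hB₁ hyc
      rw [mem_ball] at hyb
      linarith
    have hpos₁ : Position α F₁ p N₁ V₁ :=
      ⟨(hpos.isOpen.inter (isOpen_room _ _ _)).inter isOpen_ball,
        ⟨c₁, ⟨hBV hc₁, hroom _ hB₁⟩, mem_ball_self (by positivity)⟩,
        inter_subset_left.trans inter_subset_right, hF₁sub.trans (hroom _),
        disjoint_left.2 fun y hy hyV => hF₁far y hy hyV.2⟩
    obtain ⟨Z, hZQ, hZfin, hZ⟩ := hQ.finite_cover_balls (show 0 < r / 8 by positivity)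
    set P := (S ×ˢ hZfin.toFinset).filter fun a =>
      ∃ x ∈ Q, l x = c₁ ∧ closedBall a.2 (r / 2) ⊆ ball x r with hP
    obtain ⟨s₂, N₂, V₂, hpos₂, hN₂, hs₂, hV₂, hav⟩ := L.avoids_finite P
      (fun a => Q ∩ {v | v a.1 = a.2 a.1} ∩ closedBall a.2 (r / 2))
      (fun a ha => ih _ F₁ (FlatBelow.slice hQ hQconv hS hSflat
        (Finset.mem_product.1 (Finset.mem_filter.1 ha).1).1 a.2 (r / 2)) (by
          rw [hF₁, Finset.card_insert_of_notMem (hFB _ hc₀)]; omega)) hpos₁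
      (fun a ha p' hp' x hx => by
        obtain ⟨-, z, hzQ, hz, hsub⟩ := Finset.mem_filter.1 ha
        obtain ⟨y, hy, hyd⟩ := hl z hzQ p' hp'.1 (hp'.2.1.mono (le_max_right _ _)) x
          ⟨hx.2, hsub hx.1.2⟩
        refine ⟨y, ?_, hy⟩
        rw [hz] at hyd
        exact (hp'.2.2 (L.mem_of_lab p' hp'.1 x hx.2 y hy)).resolve_left
          fun hF => hF₁far y hF hyd)
    obtain ⟨B₂, q, hB₂card, hB₂V, hqA, hqplay, hqroom⟩ := hpos₂.exists_play hα (k + 1)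
    rw [show F₁.card + (k + 1) = m by
      rw [hF₁, Finset.card_insert_of_notMem (hFB _ hc₀)]; omega] at hqplay
    have hqp : AgreeBelow N₁ q p := hqplay.2.1.trans hs₂ hN₂
    have hps : AgreeBelow N p s := hplay.2.1
    have hNN₁ : N ≤ N₁ := le_max_left _ _
    have hlab : ∀ c, ∀ p', psiMinus α p' ∈ cardEqClass X m → AgreeBelow N₁ p' q →
        ∀ x ∈ L.C p' ∩ ⋃ z ∈ {z ∈ Q | l z = c}, ball z r,
          ∃ y, L.Lab p' x y ∧ y ∈ ball c (δ / 4) := by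
      rintro c p' hp' hag x ⟨hxC, hxO⟩
      obtain ⟨z, ⟨hzQ, rfl⟩, hxz⟩ := mem_iUnion₂.1 hxO
      exact hl z hzQ p' hp' ((hag.trans hqp le_rfl).mono (le_max_right _ _)) x ⟨hxC, hxz⟩
    have hopen : ∀ c, IsOpen (⋃ z ∈ {z ∈ Q | l z = c}, ball z r) := fun c =>
      isOpen_biUnion fun _ _ => isOpen_ball
    have hFroom : ∀ M, (F : Set X) ⊆ room α q M := fun M y hy =>
      hqroom M (Or.inl (by rw [hF₁]; exact Finset.mem_insert_of_mem hy))
    have hFfar : ∀ c ∈ B, ∀ y ∈ F, y ∉ ball c (δ / 4) := by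
      intro c hc y hy hyb
      have := hsep y (Or.inl hy) c (Or.inr hc) fun h => hFB c hc (h ▸ hy)
      rw [mem_ball] at hyb
      linarith
    have hballs : Disjoint (ball c₀ (δ / 4)) (ball c₁ (δ / 4)) := by
      refine ball_disjoint_ball ?_
      have := hsep c₀ hB₀ c₁ hB₁ hne
      linarith
    have hV₂V : V₂ ⊆ V := hV₂.trans (inter_subset_left.trans inter_subset_left)
    have hV₂c : V₂ ⊆ ball c₁ (δ / 4) := hV₂.trans inter_subset_right
    by_cases hcase : ∃ x ∈ L.C q ∩ Q, l x = c₁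
    · obtain ⟨x, hx, hlx⟩ := hcase
      have hcover : L.C q ∩ Q ⊆ ⋃ z ∈ {z ∈ Q | l z = c₁}, ball z r := by
        intro y hy
        refine mem_iUnion₂.2 ⟨x, ⟨hx.2, hlx⟩, ?_⟩
        by_contra hyx
        rw [mem_ball, not_lt] at hyx
        obtain ⟨i, hi, z, hz, ⟨w, ⟨hwK, hwi⟩, hwz⟩, hsub⟩ := exists_slice_mem hSflat hr hZ
          ((L.convex q).inter hQconv) inter_subset_right hx hy hyx
        have := hav (i, z) (Finset.mem_filter.2 ⟨Finset.mem_product.2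
          ⟨hi, hZfin.mem_toFinset.2 hz⟩, x, hx.2, hlx, hsub⟩) q hqplay
        exact eq_empty_iff_forall_notMem.1 this w ⟨⟨⟨hwK.2, hwi⟩, hwz⟩, hwK.1⟩
      obtain ⟨N', V', hpos', hN', hV', hav'⟩ := L.exists_avoids_of_labels (F := F)
        hqplay.1 hQ (hopen c₁) hcover (hlab c₁) (V := V ∩ ball c₀ (δ / 4))
        (hpos.isOpen.inter isOpen_ball)
        ⟨c₀, ⟨hBV hc₀, mem_ball_self (by positivity)⟩, fun M => hqroom M
          (Or.inl (by rw [hF₁]; exact Finset.mem_insert_self _ _))⟩ hFroom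
        (hpos.disjoint.mono_right inter_subset_left)
        (disjoint_union_left.2 ⟨disjoint_left.2 (hFfar c₁ hc₁), hballs.mono_left inter_subset_right⟩)
      exact ⟨q, N', V', hpos', hNN₁.trans hN', hqp.trans hps hNN₁, hV'.trans inter_subset_left, hav'⟩
    · have hcover : L.C q ∩ Q ⊆ ⋃ z ∈ {z ∈ Q | l z = c₀}, ball z r := by
        intro x hx
        refine mem_iUnion₂.2 ⟨x, ⟨hx.2, ?_⟩, mem_ball_self hr⟩
        by_contra hlx
        obtain ⟨y, hy, hyd⟩ := hl x hx.2 q hqplay.1 (hqp.mono (le_max_right _ _)) x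
          ⟨hx.1, mem_ball_self hr⟩
        have hlx₁ : l x ≠ c₁ := fun h => hcase ⟨x, hx, h⟩
        have hlxA : l x ∈ (↑F ∪ ↑B : Set X) := Or.inr (hlB x hx.2)
        rcases hqplay.2.2 (L.mem_of_lab q hqplay.1 x hx.1 y hy) with hyF | hyV
        · have hyne : y ≠ l x := by
            rintro rfl
            rcases Finset.mem_insert.1 hyF with h | h
            · exact hlx h
            · exact hFB _ (hlB x hx.2) h
          have := hsep y (hF₁sub hyF) (l x) hlxA hyne
          linarith
        · have h₁ := hV₂c hyV
          rw [mem_ball] at h₁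
          have := hsep (l x) hlxA c₁ hB₁ hlx₁
          have := dist_triangle_left (l x) c₁ y
          linarith
      have hB₂ne : B₂.Nonempty := Finset.card_pos.1 (by omega)
      obtain ⟨b, hb⟩ := hB₂ne
      obtain ⟨N', V', hpos', hN', hV', hav'⟩ := L.exists_avoids_of_labels (F := F)
        hqplay.1 hQ (hopen c₀) hcover (hlab c₀) hpos₂.isOpen
        ⟨b, hB₂V hb, fun M => hqroom M (Or.inr hb)⟩ hFroom
        (hpos.disjoint.mono_right hV₂V)
        (disjoint_union_left.2 ⟨disjoint_left.2 (hFfar c₀ hc₀),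
          hballs.symm.mono_left hV₂c⟩)
      exact ⟨q, N', V', hpos', hNN₁.trans hN', hqp.trans hps hNN₁, hV'.trans hV₂V, hav'⟩

end Avoidance

section Reduction

theorem ContinuousOn.exists_agreeBelow {H : Baire → Baire} {d : Set Baire} (hH : ContinuousOn H d)
    {p : Baire} (hp : p ∈ d) (M : ℕ) :
    ∃ N, ∀ p' ∈ d, AgreeBelow N p' p → AgreeBelow M (H p') (H p) := by
  have hU : {q : Baire | AgreeBelow M q (H p)} ∈ 𝓝 (H p) :=
    (PiNat.isTopologicalBasis_cylinders fun _ : ℕ => ℕ).mem_nhds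
      (s := PiNat.cylinder (H p) M) ⟨H p, M, rfl⟩ (PiNat.self_mem_cylinder _ _)
  have := hH p hp hU
  rw [mem_map, mem_nhdsWithin_iff_exists_mem_nhds_inter] at this
  obtain ⟨u, hu, hsub⟩ := this
  obtain ⟨_, ⟨x, N, rfl⟩, hpx, hxu⟩ :=
    (PiNat.isTopologicalBasis_cylinders fun _ : ℕ => ℕ).mem_nhds_iff.1 hu
  rw [PiNat.mem_cylinder_iff] at hpx
  exact ⟨N, fun p' hp' h => hsub ⟨hxu fun i hi => (h i hi).trans (hpx i hi), hp'⟩⟩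

theorem AgreeBelow.pairB {N : ℕ} {p p' q q' : Baire} (hp : AgreeBelow N p' p)
    (hq : AgreeBelow N q' q) : AgreeBelow N (pairB p' q') (pairB p q) := by
  intro i hi
  have : i / 2 < N := (Nat.div_le_self i 2).trans_lt hi
  simp only [_root_.pairB, hp _ this, hq _ this]

theorem exists_pointName {Y : Type*} [MetricSpace Y] {β : ℕ → Y} (hβ : DenseRange β) {x : Y}
    {q : Baire} {N : ℕ} (h : ∀ i < N, dist x (β (q i)) < (2 : ℝ)⁻¹ ^ i) :
    ∃ q', AgreeBelow N q' q ∧ (pointRep β).R q' x := by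
  choose a ha using fun i : ℕ => hβ.exists_dist_lt x (show (0 : ℝ) < (2 : ℝ)⁻¹ ^ i by positivity)
  refine ⟨fun i => if i < N then q i else a i, fun i hi => by simp [hi], fun i => ?_⟩
  by_cases hi : i < N
  · simpa [hi] using h i hi
  · simpa [hi] using ha i

theorem dist_lt_of_pointRep {X : Type*} [MetricSpace X] {α : ℕ → X} {p p' : Baire} {x x' : X}
    (h : (pointRep α).R p x) (h' : (pointRep α).R p' x') {j : ℕ} (hj : AgreeBelow (j + 1) p' p)
    {ε : ℝ} (hε : 2 * (2 : ℝ)⁻¹ ^ j < ε) : dist x' x < ε := by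
  have h₁ := h j
  have h₂ := h' j
  rw [hj j (Nat.lt_succ_self j)] at h₂
  have := dist_triangle_right x' x (α (p j))
  linarith

theorem exists_two_mul_inv_pow_lt {ε : ℝ} (hε : 0 < ε) : ∃ j : ℕ, 2 * (2 : ℝ)⁻¹ ^ j < ε := by
  obtain ⟨j, hj⟩ := exists_pow_lt_of_lt_one (half_pos hε) (show (2 : ℝ)⁻¹ < 1 by norm_num)
  exact ⟨j, by linarith⟩

variable {X : Type*} [MetricSpace X] {α : ℕ → X} {m n : ℕ} {β : ℕ → (Fin n → ℝ)}
  {H K : Baire → Baire} {dH dK : Set Baire}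

/-- `K` turns every name of a solution of the convex choice instance `H p` (every name at all if
`H p` is not an instance) into a name of a point of the set named by `p`. -/
def Solves (α : ℕ → X) (β : ℕ → (Fin n → ℝ)) (m : ℕ) (H K : Baire → Baire)
    (dH dK : Set Baire) : Prop :=
  ∀ p, psiMinus α p ∈ cardEqClass X m → p ∈ dH ∧ ∀ q,
    (psiMinus β (H p) ∈ convexClass n → ∃ x ∈ psiMinus β (H p), (pointRep β).R q x) →
      pairB p q ∈ dK ∧ ∃ y ∈ psiMinus α p, (pointRep α).R (K (pairB p q)) y

theorem exists_solves (hm : 0 < m) (hβ : DenseRange β)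
    (h : WRed (closedRep α) (pointRep α) (closedRep β) (pointRep β)
      (choiceFn (cardEqClass X m)) (choiceFn (convexClass n))) :
    ∃ (H K : Baire → Baire) (dH dK : Set Baire), ContinuousOn H dH ∧ ContinuousOn K dK ∧
      Solves α β m H K dH dK := by
  classical
  obtain ⟨H, K, dH, dK, hH, hK, hred⟩ := h
  refine ⟨H, K, dH, dK, hH, hK, fun p hp => ?_⟩
  have hbase : ∀ w : Baire, ∃ q, psiMinus β w ∈ convexClass n →
      ∃ x ∈ psiMinus β w, (pointRep β).R q x := by
    intro w
    by_cases hw : psiMinus β w ∈ convexClass n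
    · obtain ⟨x, hx⟩ := hw.1
      obtain ⟨q, -, hq⟩ := exists_pointName (q := 0) (N := 0) hβ (x := x) (by simp)
      exact ⟨q, fun _ => ⟨x, hx, hq⟩⟩
    · exact ⟨0, fun h => (hw h).elim⟩
  choose G₀ hG₀ using hbase
  have hne : (choiceFn (cardEqClass X m) (psiMinus α p)).Nonempty := by
    have : (psiMinus α p).Nonempty := by
      rw [← ncard_pos hp.1, hp.2]; exact hm
    obtain ⟨y, hy⟩ := this
    exact ⟨y, hp, hy⟩
  have key : ∀ q, (psiMinus β (H p) ∈ convexClass n →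
      ∃ x ∈ psiMinus β (H p), (pointRep β).R q x) → p ∈ dH ∧
      pairB p q ∈ dK ∧ ∃ y ∈ psiMinus α p, (pointRep α).R (K (pairB p q)) y := by
    intro q hq
    have hreal : Realizes (closedRep β) (pointRep β) (choiceFn (convexClass n))
        (Function.update G₀ (H p) q) := by
      rintro w A (rfl : A = psiMinus β w) ⟨_, hA, -⟩
      by_cases hw : w = H p
      · subst hw
        obtain ⟨x, hx, hqx⟩ := hq hA
        exact ⟨x, ⟨hA, hx⟩, by simpa using hqx⟩
      · obtain ⟨x, hx, hqx⟩ := hG₀ w hA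
        exact ⟨x, ⟨hA, hx⟩, by simpa [Function.update_of_ne hw] using hqx⟩
    obtain ⟨h₁, h₂, y, hy, hKy⟩ := hred _ hreal p _ rfl hne
    rw [Function.update_self] at h₂ hKy
    exact ⟨h₁, h₂, y, hy.2, hKy⟩
  exact ⟨(key (G₀ (H p)) (hG₀ (H p))).1, fun q hq => (key q hq).2⟩

/-- The closed convex hull of the part of the set named by `w` inside the unit cube. -/
noncomputable def cubeHull (β : ℕ → (Fin n → ℝ)) (w : Baire) : Set (Fin n → ℝ) :=
  closure (convexHull ℝ (psiMinus β w ∩ unitCube n))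

theorem cubeHull_eq {w : Baire} (h : psiMinus β w ∈ convexClass n) :
    cubeHull β w = psiMinus β w := by
  rw [cubeHull, inter_eq_left.2 h.2.2.2, h.2.2.1.convexHull_eq, h.2.1.closure_eq]

theorem isCompact_unitCube (n : ℕ) : IsCompact (unitCube n) :=
  isCompact_univ_pi fun _ => isCompact_Icc

theorem convex_unitCube (n : ℕ) : Convex ℝ (unitCube n) :=
  convex_pi fun _ _ => convex_Icc 0 1

/-- Upper semicontinuity of the closed convex hull. -/
theorem cubeHull_usc (β : ℕ → (Fin n → ℝ)) (w : Baire) {Q O : Set (Fin n → ℝ)} (hQ : IsCompact Q)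
    (hO : IsOpen O) (h : cubeHull β w ∩ Q ⊆ O) :
    ∃ M, ∀ w', AgreeBelow M w' w → cubeHull β w' ∩ Q ⊆ O := by
  have hdisj : Disjoint (cubeHull β w) (Q \ O) :=
    disjoint_left.2 fun x hx hxQ => hxQ.2 (h ⟨hx, hxQ.1⟩)
  obtain ⟨δ, hδ, hthick⟩ := hdisj.symm.exists_thickenings (hQ.diff hO) isClosed_closure
  have hcomp : IsCompact (unitCube n \ thickening (δ / 2) (cubeHull β w)) :=
    (isCompact_unitCube n).diff isOpen_thickening
  obtain ⟨t, ht⟩ := hcomp.elim_finite_subcover (fun i => ballCode β (w i)) (fun _ => isOpen_ball)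
    (by
      rintro x ⟨hx, hxt⟩
      by_contra hcov
      refine hxt (self_subset_thickening (half_pos hδ) _ (subset_closure (subset_convexHull ℝ _ ⟨?_, hx⟩)))
      exact fun i hi => hcov (mem_iUnion.2 ⟨i, hi⟩))
  refine ⟨t.sup id + 1, fun w' hw' x hx => ?_⟩
  have hsub : psiMinus β w' ∩ unitCube n ⊆ thickening (δ / 2) (cubeHull β w) := by
    rintro z ⟨hz, hzc⟩
    by_contra hzt
    obtain ⟨i, hi, hzi⟩ := mem_iUnion₂.1 (ht ⟨hzc, hzt⟩)
    refine hz i ?_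
    rw [hw' i (Nat.lt_succ_of_le (Finset.le_sup (f := id) hi))]
    exact hzi
  have hconv : Convex ℝ (thickening (δ / 2) (cubeHull β w)) :=
    ((convex_convexHull ℝ _).closure).thickening _
  have hx' : x ∈ thickening δ (cubeHull β w) :=
    cthickening_subset_thickening' hδ (by linarith) _
      (closure_thickening_subset_cthickening _ _ (closure_mono (convexHull_min hsub hconv) hx.1))
  by_contra hxO
  exact disjoint_left.1 hthick (self_subset_thickening hδ _ ⟨hx.2, hxO⟩) hx'

theorem Solves.of_mem_cubeHull (h : Solves α β m H K dH dK) {p : Baire}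
    (hp : psiMinus α p ∈ cardEqClass X m) {x : Fin n → ℝ} (hx : x ∈ cubeHull β (H p)) {q : Baire}
    (hq : (pointRep β).R q x) :
    pairB p q ∈ dK ∧ ∃ y ∈ psiMinus α p, (pointRep α).R (K (pairB p q)) y :=
  (h p hp).2 q fun hc => ⟨x, cubeHull_eq hc ▸ hx, hq⟩

/-- The labelled convex sets induced by a reduction to convex choice. -/
noncomputable def Solves.labelledConvex (hβ : DenseRange β) (hH : ContinuousOn H dH)
    (hK : ContinuousOn K dK) (h : Solves α β m H K dH dK) : LabelledConvex α m n where
  C p := cubeHull β (H p)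
  Lab p x y := ∃ q, (pointRep β).R q x ∧ (pointRep α).R (K (pairB p q)) y ∧ y ∈ psiMinus α p
  convex _ := (convex_convexHull ℝ _).closure
  isClosed _ := isClosed_closure
  usc p hp Q O hQ hO hsub := by
    obtain ⟨M, hM⟩ := cubeHull_usc β (H p) hQ hO hsub
    obtain ⟨N, hN⟩ := hH.exists_agreeBelow (h p hp).1 M
    exact ⟨N, fun p' hp' hag => hM _ (hN p' (h p' hp').1 hag)⟩
  mem_of_lab := fun _ _ _ _ _ ⟨_, _, _, hy⟩ => hy
  exists_lab p hp x hx := by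
    obtain ⟨q, -, hq⟩ := exists_pointName (q := 0) (N := 0) hβ (x := x) (by simp)
    obtain ⟨-, y, hy, hKy⟩ := h.of_mem_cubeHull hp hx hq
    exact ⟨y, q, hq, hKy, hy⟩
  lab_stable := by
    rintro p hp x hx y ⟨q, hq, hKy, hy⟩ ε hε
    obtain ⟨j, hj⟩ := exists_two_mul_inv_pow_lt hε
    obtain ⟨N, hN⟩ := hK.exists_agreeBelow (h.of_mem_cubeHull hp hx hq).1 (j + 1)
    have hopen : IsOpen (⋂ i ∈ Finset.range N, ball (β (q i)) ((2 : ℝ)⁻¹ ^ i)) :=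
      isOpen_biInter_finset fun _ _ => isOpen_ball
    obtain ⟨r, hr, hball⟩ := Metric.isOpen_iff.1 hopen x (mem_iInter₂.2 fun i _ => hq i)
    refine ⟨N, r, hr, fun p' hp' hag x' hx' => ?_⟩
    obtain ⟨q', hq'q, hq'⟩ := exists_pointName hβ (x := x') (q := q) (N := N)
      fun i hi => mem_iInter₂.1 (hball hx'.2) i (Finset.mem_range.2 hi)
    obtain ⟨hd, y', hy', hKy'⟩ := h.of_mem_cubeHull hp' hx'.1 hq'
    exact ⟨y', ⟨q', hq', hKy', hy'⟩, dist_lt_of_pointRep hKy hKy' (hN _ hd (hag.pairB hq'q)) hj⟩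

theorem flatBelow_unitCube (n : ℕ) : FlatBelow (n + 1) (unitCube n) :=
  ⟨isCompact_unitCube n, convex_unitCube n, fun _ => ⟨Finset.univ, by simp, by simp⟩⟩

/-- Closed choice on sets of cardinality `n + 2` does not reduce to `n`-dimensional convex
choice, in any space without isolated points. -/
theorem not_wRed_convexClass [Nonempty X] [∀ x : X, (𝓝[≠] x).NeBot] (hα : DenseRange α)
    (hβ : DenseRange β) :
    ¬ WRed (closedRep α) (pointRep α) (closedRep β) (pointRep β)
        (choiceFn (cardEqClass X (n + 2))) (choiceFn (convexClass n)) := by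
  intro hred
  obtain ⟨H, K, dH, dK, hH, hK, hsol⟩ := exists_solves (by omega) hβ hred
  let L := hsol.labelledConvex hβ hH hK
  have hpos : Position α ∅ 0 0 univ :=
    ⟨isOpen_univ, univ_nonempty, fun x _ i hi => (Nat.not_lt_zero i hi).elim, by simp, by simp⟩
  obtain ⟨s, N, V, hpos, -, -, -, hav⟩ := L.avoidable_of_flatBelow hα (n + 1) (unitCube n) ∅
    (flatBelow_unitCube n) (by simp) 0 0 univ hpos (fun p hp x hx => by
      obtain ⟨y, hy⟩ := L.exists_lab p hp.1 x hx.2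
      exact ⟨y, mem_univ y, hy⟩)
  have hout : ∀ p ∈ plays α (n + 2) s N (↑(∅ : Finset X) ∪ V),
      pairB p 0 ∈ dK ∧ ∃ y ∈ psiMinus α p, (pointRep α).R (K (pairB p 0)) y := by
    refine fun p hp => (hsol p hp.1).2 0 fun hc => ?_
    obtain ⟨x, hx⟩ := hc.1
    have hxC : x ∈ L.C p := by
      change x ∈ cubeHull β (H p)
      rwa [cubeHull_eq hc]
    exact (eq_empty_iff_forall_notMem.1 (hav p hp) x ⟨hc.2.2.2 hx, hxC⟩).elim
  obtain ⟨B, p, hB, hBV, -, hp, hroom⟩ := hpos.exists_play hα (n + 2)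
  rw [Finset.card_empty, zero_add] at hp
  obtain ⟨hd, y, -, hKy⟩ := hout p hp
  obtain ⟨c, hc, hcy⟩ := Finset.exists_mem_ne (show 1 < B.card by omega) y
  have hδ : 0 < dist c y / 2 := half_pos (dist_pos.2 hcy)
  obtain ⟨j, hj⟩ := exists_two_mul_inv_pow_lt hδ
  obtain ⟨M, hM⟩ := hK.exists_agreeBelow hd (j + 1)
  have hpos' : Position α ∅ p (max N M) (V ∩ room α p (max N M) ∩ ball c (dist c y / 2)) :=
    ⟨(hpos.isOpen.inter (isOpen_room _ _ _)).inter isOpen_ball,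
      ⟨c, ⟨hBV hc, hroom _ (Or.inr hc)⟩, mem_ball_self hδ⟩,
      inter_subset_left.trans inter_subset_right, by simp, by simp⟩
  obtain ⟨-, p', -, -, -, hp', -⟩ := hpos'.exists_play hα (n + 2)
  rw [Finset.card_empty, zero_add] at hp'
  obtain ⟨hd', y', hy', hKy'⟩ := hout p' (plays_subset hp.2.1 (le_max_left _ _)
    (union_subset_union_right _ (inter_subset_left.trans inter_subset_left)) hp')
  have hyy : dist y' y < dist c y / 2 := dist_lt_of_pointRep hKy hKy'
    (hM _ hd' ((hp'.2.1.mono (le_max_right _ _)).pairB (AgreeBelow.refl _ _))) hj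
  have hyc : dist y' c < dist c y / 2 := by
    have := hp'.2.2 hy'
    simp only [Finset.coe_empty, empty_union] at this
    exact this.2
  have := dist_triangle_left c y y'
  linarith

end Reduction

end CardinalityVersusConvexity

/-- For every n ≥ 1, C_{[0,1],#=n+2} ≰_W XC_n. -/
theorem stmt0 (n : ℕ) (hn : 1 ≤ n)
    (α : ℕ → ↥(Set.Icc (0:ℝ) 1)) (hα : DenseRange α)
    (β : ℕ → (Fin n → ℝ)) (hβ : DenseRange β) :
    ¬ WRed (closedRep α) (pointRep α) (closedRep β) (pointRep β)
        (choiceFn (cardEqClass ↥(Set.Icc (0:ℝ) 1) (n + 2)))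
        (choiceFn (convexClass n)) := by
  have : Nonempty ↥(Set.Icc (0:ℝ) 1) := ⟨⟨0, by norm_num⟩⟩
  exact not_wRed_convexClass hα hβ
end

section
/- For every n ≥ 1, choice for n-point subsets of Cantor space is strictly below choice for (n+1)-point subsets: C_{{0,1}^ℕ,#=n} ≤_W C_{{0,1}^ℕ,#=n+1}, and C_{{0,1}^ℕ,#=n+1} ≰_W C_{{0,1}^ℕ,#=n}. -/
section Choice

open Filter Topology Metric Set

/-! Neighbourhoods in Baire space. -/

theorem Baire.eventually_agree (p : Baire) (s : ℕ) : ∀ᶠ q in 𝓝 p, ∀ j < s, q j = p j := by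
  have h : ∀ j, ∀ᶠ q : Baire in 𝓝 p, q j = p j := fun j =>
    have hj : ∀ᶠ m in 𝓝 (p j), m = p j := by simp [nhds_discrete]
    (continuous_apply j).continuousAt.eventually hj
  exact (Filter.eventually_all_finite (finite_lt_nat s)).2 fun j _ => h j

theorem Baire.exists_forall_agree {p : Baire} {P : Baire → Prop} (h : ∀ᶠ q in 𝓝 p, P q) :
    ∃ s, ∀ q : Baire, (∀ j < s, q j = p j) → P q := by
  obtain ⟨U, hUP, hU, hpU⟩ := _root_.mem_nhds_iff.1 h
  obtain ⟨I, u, hu, hsub⟩ := isOpen_pi_iff.1 hU p hpU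
  refine ⟨I.sup id + 1, fun q hq => hUP (hsub fun i hi => ?_)⟩
  rw [hq i (Nat.lt_succ_of_le (Finset.le_sup (f := id) hi))]
  exact (hu i hi).2

theorem Baire.continuousOn_of_eventually_eq {X : Type*} [TopologicalSpace X] {F : X → Baire}
    {D : Set X} (h : ∀ p ∈ D, ∀ i, ∀ᶠ q in 𝓝[D] p, F q i = F p i) : ContinuousOn F D := by
  refine continuousOn_pi.2 fun i p hp => ?_
  have := h p hp i
  exact Filter.Tendsto.congr' (this.mono fun q hq => hq.symm) tendsto_const_nhds

theorem ContinuousOn.eventually_coord_eq {X : Type*} [TopologicalSpace X] {F : X → Baire}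
    {D : Set X} (h : ContinuousOn F D) {p : X} (hp : p ∈ D) (i : ℕ) :
    ∀ᶠ q in 𝓝[D] p, F q i = F p i :=
  have hi : ∀ᶠ m in 𝓝 (F p i), m = F p i := by simp [nhds_discrete]
  (continuousOn_pi.1 h i p hp).eventually hi

theorem pairB_two_mul_add_one (p q : Baire) (i : ℕ) : pairB p q (2 * i + 1) = q i := by
  simp only [pairB]
  rw [if_neg (by omega), show (2 * i + 1) / 2 = i by omega]

theorem pairB_agree {p q p' q' : Baire} {s : ℕ} (hp : ∀ j < s, p' j = p j)
    (hq : ∀ j < s, q' j = q j) : ∀ j < s, pairB p' q' j = pairB p q j := by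
  intro j hj
  have : j / 2 < s := by omega
  simp [pairB, hp _ this, hq _ this]

open Classical in
/-- An element of `T` that is contained in `M` if there is one, and any element otherwise. -/
noncomputable def selectSubset {α : Type*} (T : Set (Set α)) (M : Set α) : Set α :=
  if h : ∃ S ∈ T, S ⊆ M then h.choose else if h : T.Nonempty then h.some else ∅

theorem selectSubset_mem {α : Type*} {T : Set (Set α)} (hT : T.Nonempty) (M : Set α) :
    selectSubset T M ∈ T := by
  unfold selectSubset
  split_ifs with h
  · exact h.choose_spec.1
  · exact hT.some_mem

theorem selectSubset_subset {α : Type*} {T : Set (Set α)} {M : Set α} (h : ∃ S ∈ T, S ⊆ M) :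
    selectSubset T M ⊆ M := by
  unfold selectSubset
  rw [dif_pos h]
  exact h.choose_spec.2

/-! Names of closed sets and of points. -/

section General

variable {X : Type*} [MetricSpace X] {γ : ℕ → X}

theorem ballCode_zero_s2 : ballCode γ 0 = ∅ := by
  simp [ballCode, ratCode]

theorem isOpen_ballCode (c : ℕ) : IsOpen (ballCode γ c) := isOpen_ball

theorem exists_ballCode (hγ : DenseRange γ) {x : X} {U : Set X} (hU : U ∈ 𝓝 x) :
    ∃ c, x ∈ ballCode γ c ∧ ballCode γ c ⊆ U := by
  obtain ⟨ε, hε, hεU⟩ := Metric.mem_nhds_iff.1 hU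
  obtain ⟨b, hb⟩ := exists_nat_one_div_lt (half_pos hε)
  have hb0 : (0 : ℝ) < 1 / ((b : ℝ) + 1) := by positivity
  obtain ⟨a, ha⟩ := hγ.exists_dist_lt x hb0
  refine ⟨Nat.pair a (Nat.pair 1 b), ?_, fun y hy => hεU ?_⟩
  · simpa [ballCode, ratCode] using ha
  · have hy' : dist y (γ a) < 1 / ((b : ℝ) + 1) := by simpa [ballCode, ratCode] using hy
    rw [mem_ball]
    linarith [dist_triangle_right y x (γ a)]

/-- A family of closed sets whose graph is closed over `D` has a continuous choice of names
on `D`. -/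
theorem exists_continuousOn_name (hγ : DenseRange γ) (D : Set Baire) (B : Baire → Set X)
    (hB : ∀ p ∈ D, ∀ x ∉ B p, ∀ᶠ w in 𝓝[D] p ×ˢ 𝓝 x, w.2 ∉ B w.1) :
    ∃ H : Baire → Baire, ContinuousOn H D ∧ ∀ p ∈ D, psiMinus γ (H p) = B p := by
  classical
  let good : Baire → ℕ → Prop := fun p i =>
    ∀ q ∈ D, (∀ j < i.unpair.2, q j = p j) → Disjoint (B q) (ballCode γ i.unpair.1)
  refine ⟨fun p i => if good p i then i.unpair.1 else 0,
    Baire.continuousOn_of_eventually_eq fun p _ i => ?_, fun p hp => ?_⟩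
  · refine eventually_nhdsWithin_of_eventually_nhds
      ((Baire.eventually_agree p i.unpair.2).mono fun q hq => ?_)
    have : good q i ↔ good p i := by
      refine forall₂_congr fun r _ => imp_congr_left (forall₂_congr fun j hj => ?_)
      rw [hq j hj]
    simp only [this]
  · ext x
    constructor
    · intro hx
      by_contra hxB
      obtain ⟨P, hP, Q, hQ, hPQ⟩ := Filter.eventually_prod_iff.1 (hB p hp x hxB)
      obtain ⟨s, hs⟩ := Baire.exists_forall_agree (eventually_nhdsWithin_iff.1 hP)
      obtain ⟨c, hxc, hc⟩ := exists_ballCode hγ hQ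
      have hgood : good p (Nat.pair c s) := by
        intro q hq hqp
        simp only [Nat.unpair_pair] at hqp ⊢
        exact Set.disjoint_right.2 fun y hy => hPQ (hs q hqp hq) (hc hy)
      refine hx (Nat.pair c s) ?_
      simp only [hgood, if_true, Nat.unpair_pair]
      exact hxc
    · intro hx i hxi
      by_cases h : good p i
      · simp only [h, if_true] at hxi
        exact Set.disjoint_left.1 (h p hp fun _ _ => rfl) hx hxi
      · simp [h, ballCode_zero_s2] at hxi

theorem exists_name_of_agree (hγ : DenseRange γ) {F : Set X} (hF : IsClosed F) (p : Baire)
    (s : ℕ) (h : ∀ i < s, Disjoint F (ballCode γ (p i))) :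
    ∃ p' : Baire, (∀ i < s, p' i = p i) ∧ psiMinus γ p' = F := by
  classical
  refine ⟨fun i => if i < s then p i else if Disjoint F (ballCode γ (i - s)) then i - s else 0,
    fun i hi => by simp [hi], ?_⟩
  ext x
  constructor
  · intro hx
    by_contra hxF
    obtain ⟨c, hxc, hc⟩ := exists_ballCode hγ (hF.isOpen_compl.mem_nhds hxF)
    have hd : Disjoint F (ballCode γ c) := (Set.subset_compl_iff_disjoint_left.1 hc)
    refine hx (c + s) ?_
    simpa [hd] using hxc
  · intro hx i
    dsimp only
    split_ifs with h1 h2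
    · exact Set.disjoint_left.1 (h i h1) hx
    · exact Set.disjoint_left.1 h2 hx
    · simp [ballCode_zero_s2]

/-- The points not yet excluded by the first `t` balls of a name. -/
def aliveSet (γ : ℕ → X) (p : Baire) (t : ℕ) : Set X := {x | ∀ i < t, x ∉ ballCode γ (p i)}

theorem psiMinus_subset_aliveSet (p : Baire) (t : ℕ) : psiMinus γ p ⊆ aliveSet γ p t :=
  fun _ hx i _ => hx i

theorem aliveSet_congr {p q : Baire} {t : ℕ} (h : ∀ j < t, q j = p j) :
    aliveSet γ q t = aliveSet γ p t := by
  ext x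
  exact forall₂_congr fun j hj => by rw [h j hj]

theorem exists_aliveSet_subset [CompactSpace X] {p : Baire} {W : Set X} (hW : IsOpen W)
    (h : psiMinus γ p ⊆ W) : ∃ t, aliveSet γ p t ⊆ W := by
  refine exists_subset_nhds_of_compactSpace (V := aliveSet γ p) ?_ (fun t => ?_) ?_
  · exact directed_of_isDirected_le fun a b hab x hx i hi => hx i (hi.trans_le hab)
  · simp only [aliveSet, Set.ofPred_forall]
    exact isClosed_iInter fun i => isClosed_iInter fun _ => (isOpen_ballCode (p i)).isClosed_compl
  · intro x hx
    refine hW.mem_nhds (h fun i => ?_)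
    exact Set.mem_iInter.1 hx (i + 1) i (Nat.lt_succ_self i)

theorem exists_pointName_s2 (hγ : DenseRange γ) (x : X) : ∃ q, (pointRep γ).R q x := by
  choose q hq using fun i : ℕ => hγ.exists_dist_lt x (ε := (2 : ℝ)⁻¹ ^ i) (by positivity)
  exact ⟨q, hq⟩

/-- There is a realizer of closed choice with a prescribed admissible value at `p₀`. -/
theorem exists_realizer (hγ : DenseRange γ) (𝔄 : Set (Set X)) (p₀ q₀ : Baire)
    (h : psiMinus γ p₀ ∈ 𝔄 → ∃ y ∈ psiMinus γ p₀, (pointRep γ).R q₀ y) :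
    ∃ G, Realizes (closedRep γ) (pointRep γ) (choiceFn 𝔄) G ∧ G p₀ = q₀ := by
  classical
  have hex : ∀ p, ∃ q, (p = p₀ → q = q₀) ∧ (psiMinus γ p ∈ 𝔄 → (psiMinus γ p).Nonempty →
      ∃ y ∈ psiMinus γ p, (pointRep γ).R q y) := by
    intro p
    by_cases hp : p = p₀
    · subst hp
      exact ⟨q₀, fun _ => rfl, fun h' _ => h h'⟩
    · by_cases hn : (psiMinus γ p).Nonempty
      · obtain ⟨y, hy⟩ := hn
        obtain ⟨q, hq⟩ := exists_pointName_s2 hγ y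
        exact ⟨q, fun h' => absurd h' hp, fun _ _ => ⟨y, hy, hq⟩⟩
      · exact ⟨q₀, fun _ => rfl, fun _ h' => absurd h' hn⟩
  choose G hG₀ hG using hex
  refine ⟨G, ?_, hG₀ p₀ rfl⟩
  rintro p A hA ⟨x, hx𝔄, hx⟩
  change A = psiMinus γ p at hA
  subst hA
  obtain ⟨y, hy, hyq⟩ := hG p hx𝔄 ⟨x, hx⟩
  exact ⟨y, ⟨hx𝔄, hy⟩, hyq⟩

/-- Any finite part of a name `p` extends to a name of an `m`-point set lying in a prescribed ball
around a point of the set named by `p`. -/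
theorem exists_name_in_ball [IsUltrametricDist X] (hγ : DenseRange γ)
    (hinf : ∀ U : Set X, IsOpen U → U.Nonempty → U.Infinite) {p : Baire} {a : X}
    (ha : a ∈ psiMinus γ p) {r : ℝ} (hr : 0 < r) (s m : ℕ) :
    ∃ p' : Baire, (∀ j < s, p' j = p j) ∧ psiMinus γ p' ∈ cardEqClass X m ∧
      psiMinus γ p' ⊆ ball a r := by
  have hU : IsOpen (ball a r ∩ aliveSet γ p s) := by
    refine isOpen_ball.inter ?_
    simp only [aliveSet, Set.ofPred_forall]
    exact (finite_lt_nat s).isOpen_biInter fun i _ =>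
      (IsUltrametricDist.isClosed_ball _ _).isOpen_compl
  obtain ⟨F, hFU, hF, hFm⟩ := (hinf _ hU ⟨a, mem_ball_self hr,
    psiMinus_subset_aliveSet p s ha⟩).exists_subset_ncard_eq m
  obtain ⟨p', hp', hF'⟩ := exists_name_of_agree hγ hF.isClosed p s
    fun i hi => Set.disjoint_left.2 fun x hx => (hFU hx).2 i hi
  exact ⟨p', hp', by rw [hF']; exact ⟨hF, hFm⟩, by rw [hF']; exact fun x hx => (hFU hx).1⟩

/-- For `H` continuous on `D`, there is a name in `D` at which at most `n` admissible answers
approximate admissible answers at all nearby names in `D`. -/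
theorem exists_approximating_answers [CompactSpace X] (hγ : DenseRange γ)
    {n : ℕ} (hn : 1 ≤ n) {H : Baire → Baire} {D : Set Baire} (hH : ContinuousOn H D)
    (hD : D.Nonempty) :
    ∃ p ∈ D, ∃ Q : Set Baire, Q.Finite ∧ Q.ncard ≤ n ∧
      (∀ q ∈ Q, psiMinus γ (H p) ∈ cardEqClass X n →
        ∃ y ∈ psiMinus γ (H p), (pointRep γ).R q y) ∧
      ∀ N, ∀ᶠ p' in 𝓝[D] p, ∃ q ∈ Q, ∃ q' : Baire, (∀ i < N, q' i = q i) ∧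
        (psiMinus γ (H p') ∈ cardEqClass X n →
          ∃ y ∈ psiMinus γ (H p'), (pointRep γ).R q' y) := by
  classical
  by_cases hex : ∃ p ∈ D, psiMinus γ (H p) ∈ cardEqClass X n
  · obtain ⟨p, hp, hpn⟩ := hex
    choose name hname using exists_pointName_s2 hγ
    have hne : ∀ r, psiMinus γ r ∈ cardEqClass X n → (psiMinus γ r).Nonempty := fun r hr =>
      Set.nonempty_of_ncard_ne_zero (by have := hr.2; omega)
    refine ⟨p, hp, name '' psiMinus γ (H p), hpn.1.image _,
      (Set.ncard_image_le hpn.1).trans hpn.2.le, ?_, fun N => ?_⟩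
    · rintro _ ⟨b, hb, rfl⟩ _
      exact ⟨b, hb, hname b⟩
    · let W : X → Set X := fun b => {y | ∀ i < N, dist y (γ (name b i)) < (2 : ℝ)⁻¹ ^ i}
      have hW : ∀ b, IsOpen (W b) := fun b => by
        simp only [W, Set.ofPred_forall]
        exact (finite_lt_nat N).isOpen_biInter fun i _ => isOpen_ball
      obtain ⟨t, ht⟩ := exists_aliveSet_subset (p := H p)
        (W := ⋃ b ∈ psiMinus γ (H p), W b) (isOpen_biUnion fun b _ => hW b)
        fun b hb => Set.mem_biUnion hb fun i _ => hname b i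
      have hev : ∀ᶠ p' in 𝓝[D] p, ∀ j < t, H p' j = H p j :=
        (Filter.eventually_all_finite (finite_lt_nat t)).2 fun j _ => hH.eventually_coord_eq hp j
      filter_upwards [hev] with p' hp'
      by_cases hpn' : psiMinus γ (H p') ∈ cardEqClass X n
      · obtain ⟨y, hy⟩ := hne _ hpn'
        have hyt := psiMinus_subset_aliveSet (H p') t hy
        rw [aliveSet_congr hp'] at hyt
        obtain ⟨b, hb, hyb⟩ := Set.mem_iUnion₂.1 (ht hyt)
        refine ⟨name b, ⟨b, hb, rfl⟩, fun i => if i < N then name b i else name y i,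
          fun i hi => by simp [hi], fun _ => ⟨y, hy, fun i => ?_⟩⟩
        dsimp only
        split_ifs with hi
        · exact hyb i hi
        · exact hname y i
      · obtain ⟨b, hb⟩ := hne _ hpn
        exact ⟨name b, ⟨b, hb, rfl⟩, name b, fun _ _ => rfl, fun h => absurd h hpn'⟩
  · push Not at hex
    obtain ⟨p, hp⟩ := hD
    refine ⟨p, hp, {0}, Set.finite_singleton _, by simpa using hn,
      fun _ _ h => absurd h (hex p hp), fun N => ?_⟩
    filter_upwards [self_mem_nhdsWithin] with p' hp'
    exact ⟨0, rfl, 0, fun _ _ => rfl, fun h => absurd h (hex p' hp')⟩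

theorem not_wRed_choice_cardEq_succ [CompactSpace X] [IsUltrametricDist X] [Nonempty X]
    (hγ : DenseRange γ) (hinf : ∀ U : Set X, IsOpen U → U.Nonempty → U.Infinite)
    {n : ℕ} (hn : 1 ≤ n) :
    ¬ WRed (closedRep γ) (pointRep γ) (closedRep γ) (pointRep γ)
        (choiceFn (cardEqClass X (n + 1))) (choiceFn (cardEqClass X n)) := by
  rintro ⟨H, K, dH, dK, hH, hK, hred⟩
  set D : Set Baire := {p | psiMinus γ p ∈ cardEqClass X (n + 1)} with hDdef
  have key : ∀ p ∈ D, ∀ q, (psiMinus γ (H p) ∈ cardEqClass X n →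
      ∃ y ∈ psiMinus γ (H p), (pointRep γ).R q y) →
      p ∈ dH ∧ pairB p q ∈ dK ∧ ∃ y ∈ psiMinus γ p, (pointRep γ).R (K (pairB p q)) y := by
    intro p hp q hq
    obtain ⟨G, hG, hGq⟩ := exists_realizer hγ _ (H p) q hq
    have hne : (psiMinus γ p).Nonempty := Set.nonempty_of_ncard_ne_zero (by have := hp.2; omega)
    obtain ⟨h1, h2, y, hy, hyK⟩ := hred G hG p _ rfl (hne.mono fun x hx => ⟨hp, hx⟩)
    rw [hGq] at h2 hyK
    exact ⟨h1, h2, y, hy.2, hyK⟩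
  have hDH : D ⊆ dH := fun p hp => by
    obtain ⟨q, hq⟩ : ∃ q, psiMinus γ (H p) ∈ cardEqClass X n →
        ∃ y ∈ psiMinus γ (H p), (pointRep γ).R q y := by
      by_cases hpn : psiMinus γ (H p) ∈ cardEqClass X n
      · obtain ⟨y, hy⟩ : (psiMinus γ (H p)).Nonempty :=
          Set.nonempty_of_ncard_ne_zero (by have := hpn.2; omega)
        obtain ⟨q, hq⟩ := exists_pointName_s2 hγ y
        exact ⟨q, fun _ => ⟨y, hy, hq⟩⟩
      · exact ⟨0, fun h => absurd h hpn⟩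
    exact (key p hp q hq).1
  have hD : D.Nonempty := by
    obtain ⟨x⟩ := ‹Nonempty X›
    have hx : x ∈ psiMinus γ (fun _ => 0) := fun i => by simp [ballCode_zero_s2]
    obtain ⟨p, -, hp, -⟩ := exists_name_in_ball hγ hinf hx one_pos 0 (n + 1)
    exact ⟨p, hp⟩
  obtain ⟨p, hp, Q, hQ, hQn, hQp, hQev⟩ :=
    exists_approximating_answers (X := X) (γ := γ) hγ hn (hH.mono hDH) hD
  choose! y hy hyK using fun q hq => (key p hp q (hQp q hq)).2.2
  obtain ⟨a, ha, hay⟩ := Set.exists_mem_notMem_of_ncard_lt_ncard (s := y '' Q)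
    (t := psiMinus γ p) (by
      have := Set.ncard_image_le (f := y) hQ
      have := hp.2
      omega) (hQ.image y)
  obtain ⟨j, hj⟩ : ∃ j : ℕ, ∀ q ∈ Q, (2 : ℝ)⁻¹ ^ j ≤ dist a (y q) := by
    have : ∀ᶠ j : ℕ in atTop, ∀ q ∈ Q, (2 : ℝ)⁻¹ ^ j ≤ dist a (y q) := by
      refine (Filter.eventually_all_finite hQ).2 fun q hq => ?_
      have hpos : 0 < dist a (y q) := dist_pos.2 fun h => hay ⟨q, hq, h.symm⟩
      exact ((tendsto_pow_atTop_nhds_zero_of_lt_one (by norm_num) (by norm_num)).eventually_lt_const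
        hpos).mono fun _ h => h.le
    exact this.exists
  obtain ⟨N, hN⟩ : ∃ N : ℕ, ∀ q ∈ Q, ∀ r ∈ dK, (∀ i < N, r i = pairB p q i) →
      K r j = K (pairB p q) j := by
    have : ∀ᶠ N : ℕ in atTop, ∀ q ∈ Q, ∀ r ∈ dK, (∀ i < N, r i = pairB p q i) →
        K r j = K (pairB p q) j := by
      refine (Filter.eventually_all_finite hQ).2 fun q hq => ?_
      obtain ⟨N, hN⟩ := Baire.exists_forall_agree (eventually_nhdsWithin_iff.1
        (hK.eventually_coord_eq (key p hp q (hQp q hq)).2.1 j))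
      filter_upwards [eventually_ge_atTop N] with M hM r hr hrM
      exact hN r (fun i hi => hrM i (hi.trans_le hM)) hr
    exact this.exists
  obtain ⟨s, hs⟩ := Baire.exists_forall_agree (eventually_nhdsWithin_iff.1 (hQev N))
  obtain ⟨p', hp', hp'D, hp'a⟩ := exists_name_in_ball hγ hinf ha
    (r := (2 : ℝ)⁻¹ ^ j) (by positivity) (max s N) (n + 1)
  obtain ⟨q, hq, q', hqq', hadm⟩ := hs p' (fun i hi => hp' i (lt_max_of_lt_left hi)) hp'D
  obtain ⟨-, hdK, y', hy', hyK'⟩ := key p' hp'D q' hadm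
  have hKeq := hN q hq _ hdK (pairB_agree (fun i hi => hp' i (lt_max_of_lt_right hi)) hqq')
  have h1 := hyK' j
  rw [hKeq] at h1
  have h2 := hyK q hq j
  have h3 := hp'a hy'
  have h4 : dist y' (y q) < (2 : ℝ)⁻¹ ^ j :=
    (dist_triangle_max _ _ _).trans_lt (max_lt h1 (by rwa [dist_comm]))
  have h5 : dist a (y q) < (2 : ℝ)⁻¹ ^ j :=
    (dist_triangle_max _ _ _).trans_lt (max_lt (by rwa [dist_comm]) h4)
  exact absurd (hj q hq) (not_le.2 h5)

/-! Continuous translations between points and their names. -/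

theorem exists_continuous_pointName [IsUltrametricDist X] (hγ : DenseRange γ) :
    ∃ N : X → Baire, Continuous N ∧ ∀ x, (pointRep γ).R (N x) x := by
  have hc : ∀ S : Set X, ∃ a, (∃ b, γ b ∈ S) → γ a ∈ S := fun S => by
    by_cases h : ∃ b, γ b ∈ S
    · exact ⟨h.choose, fun _ => h.choose_spec⟩
    · exact ⟨0, fun h' => absurd h' h⟩
  choose c hc using hc
  refine ⟨fun x i => c (ball x ((2 : ℝ)⁻¹ ^ i)), ?_, fun x i => ?_⟩
  · rw [← continuousOn_univ]
    refine Baire.continuousOn_of_eventually_eq fun x _ i => ?_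
    rw [nhdsWithin_univ]
    filter_upwards [ball_mem_nhds x (show (0 : ℝ) < (2 : ℝ)⁻¹ ^ i by positivity)] with y hy
    rw [IsUltrametricDist.ball_eq_of_mem hy]
  · obtain ⟨b, hb⟩ := hγ.exists_dist_lt x (show (0 : ℝ) < (2 : ℝ)⁻¹ ^ i by positivity)
    have := hc (ball x ((2 : ℝ)⁻¹ ^ i)) ⟨b, by rwa [mem_ball, dist_comm]⟩
    rwa [mem_ball, dist_comm] at this

theorem exists_continuousOn_point [Nonempty X] :
    ∃ P : Baire → X, ContinuousOn P {q | ∃ x, (pointRep γ).R q x} ∧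
      ∀ q x, (pointRep γ).R q x → P q = x := by
  have hclose : ∀ {q q' : Baire} {x x' : X} {i : ℕ}, (pointRep γ).R q x → (pointRep γ).R q' x' →
      q i = q' i → dist x x' < 2 * (2 : ℝ)⁻¹ ^ i := by
    intro q q' x x' i hx hx' hi
    have h1 := hx i
    have h2 := hx' i
    rw [hi] at h1
    linarith [dist_triangle_right x x' (γ (q' i))]
  have htend : Tendsto (fun i : ℕ => 2 * (2 : ℝ)⁻¹ ^ i) atTop (𝓝 0) := by
    simpa using (tendsto_pow_atTop_nhds_zero_of_lt_one (r := (2 : ℝ)⁻¹)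
      (by norm_num) (by norm_num)).const_mul 2
  have hex : ∀ q, ∃ x, (∃ y, (pointRep γ).R q y) → (pointRep γ).R q x := fun q => by
    by_cases h : ∃ y, (pointRep γ).R q y
    · exact ⟨h.choose, fun _ => h.choose_spec⟩
    · exact ⟨Classical.arbitrary X, fun h' => absurd h' h⟩
  choose P hP using hex
  refine ⟨P, fun q hq => ?_, fun q x hx => ?_⟩
  · refine Metric.tendsto_nhds.2 fun ε hε => ?_
    obtain ⟨i, hi⟩ := (htend.eventually_lt_const hε).exists
    filter_upwards [self_mem_nhdsWithin,
      eventually_nhdsWithin_of_eventually_nhds (Baire.eventually_agree q (i + 1))] with q' hq' hqq'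
    exact (hclose (hP q' hq') (hP q hq) (hqq' i (Nat.lt_succ_self i))).trans hi
  · by_contra hne
    obtain ⟨i, hi⟩ := (htend.eventually_lt_const (dist_pos.2 hne)).exists
    exact absurd (hclose (hP q ⟨x, hx⟩) hx (rfl : q i = q i)) (not_lt.2 hi.le)

/-- A reduction between choice principles from a closed-graph transformation of closed sets whose
points are sent back to points of the original set by a fixed continuous map. -/
theorem wRed_choice_of_closedGraph [IsUltrametricDist X] [Nonempty X] (hγ : DenseRange γ)
    {𝔄 𝔅 : Set (Set X)} (B : Baire → Set X) {f : X → X} (hf : Continuous f)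
    (hgraph : ∀ p, psiMinus γ p ∈ 𝔄 → ∀ x ∉ B p,
      ∀ᶠ w in 𝓝[{p | psiMinus γ p ∈ 𝔄}] p ×ˢ 𝓝 x, w.2 ∉ B w.1)
    (hB : ∀ p, psiMinus γ p ∈ 𝔄 → (psiMinus γ p).Nonempty → B p ∈ 𝔅 ∧ (B p).Nonempty)
    (hfB : ∀ p, psiMinus γ p ∈ 𝔄 → ∀ z ∈ B p, f z ∈ psiMinus γ p) :
    WRed (closedRep γ) (pointRep γ) (closedRep γ) (pointRep γ) (choiceFn 𝔄) (choiceFn 𝔅) := by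
  obtain ⟨H, hH, hHB⟩ := exists_continuousOn_name hγ _ B hgraph
  obtain ⟨N, hN, hNx⟩ := exists_continuous_pointName hγ
  obtain ⟨P, hP, hPx⟩ := exists_continuousOn_point (γ := γ)
  let odd : Baire → Baire := fun r i => r (2 * i + 1)
  have hodd : Continuous odd := continuous_pi fun i => continuous_apply (2 * i + 1)
  have hodd_pair : ∀ p q, odd (pairB p q) = q := fun p q =>
    funext fun i => pairB_two_mul_add_one p q i
  refine ⟨H, fun r => N (f (P (odd r))), {p | psiMinus γ p ∈ 𝔄},
    odd ⁻¹' {q | ∃ x, (pointRep γ).R q x}, hH, ?_, ?_⟩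
  · exact (hN.comp hf).comp_continuousOn (hP.comp hodd.continuousOn fun _ h => h)
  · rintro G hG p A hA ⟨x, hx𝔄, hx⟩
    change A = psiMinus γ p at hA
    subst hA
    obtain ⟨hB𝔅, z₀, hz₀⟩ := hB p hx𝔄 ⟨x, hx⟩
    obtain ⟨z, ⟨-, hz⟩, hzG⟩ := hG (H p) (B p) (hHB p hx𝔄).symm ⟨z₀, hB𝔅, hz₀⟩
    refine ⟨hx𝔄, ?_, f z, ⟨hx𝔄, hfB p hx𝔄 z hz⟩, ?_⟩
    · rw [Set.mem_preimage, hodd_pair]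
      exact ⟨z, hzG⟩
    · dsimp only
      rw [hodd_pair, hPx _ z hzG]
      exact hNx _

/-! A locally constant sequence of balls, eventually shrinking around a single point of a given
`n`-point set. -/

/-- The balls of radius `2⁻ᵏ` around the points not yet excluded at stage `t`. -/
def aliveBalls (γ : ℕ → X) (k : ℕ) (p : Baire) (t : ℕ) : Set (Set X) :=
  (fun x => ball x ((2 : ℝ)⁻¹ ^ k)) '' aliveSet γ p t

/-- The first stage at which at most `n` balls of radius `2⁻ᵏ` are left. -/
noncomputable def aliveStage (γ : ℕ → X) (n k : ℕ) (p : Baire) : ℕ :=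
  sInf {t | (aliveBalls γ k p t).Finite ∧ (aliveBalls γ k p t).ncard ≤ n}

/-- The followed ball of radius `2⁻ᵏ`: it stays inside its predecessor whenever possible. -/
noncomputable def followedBall (γ : ℕ → X) (n : ℕ) (p : Baire) : ℕ → Set X
  | 0 => selectSubset (aliveBalls γ 0 p (aliveStage γ n 0 p)) univ
  | k + 1 => selectSubset (aliveBalls γ (k + 1) p (aliveStage γ n (k + 1) p))
      (followedBall γ n p k)

theorem followedBall_mem {n : ℕ} {p : Baire} (hne : (psiMinus γ p).Nonempty) (k : ℕ) :
    followedBall γ n p k ∈ aliveBalls γ k p (aliveStage γ n k p) := by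
  have hT : ∀ k, (aliveBalls γ k p (aliveStage γ n k p)).Nonempty := fun k =>
    (hne.mono (psiMinus_subset_aliveSet p _)).image _
  cases k <;> exact selectSubset_mem (hT _) _

theorem isClopen_followedBall [IsUltrametricDist X] {n : ℕ} {p : Baire}
    (hne : (psiMinus γ p).Nonempty) (k : ℕ) :
    IsClopen (followedBall γ n p k) := by
  obtain ⟨x, -, hx⟩ := followedBall_mem (n := n) hne k
  rw [← hx]
  exact IsUltrametricDist.isClopen_ball _ _

section Followed

variable [CompactSpace X] [IsUltrametricDist X] {n : ℕ} {p : Baire}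

theorem aliveStage_spec (hp : psiMinus γ p ∈ cardEqClass X n) (k : ℕ) :
    (aliveBalls γ k p (aliveStage γ n k p)).Finite ∧
      (aliveBalls γ k p (aliveStage γ n k p)).ncard ≤ n := by
  refine Nat.sInf_mem
    (s := {t | (aliveBalls γ k p t).Finite ∧ (aliveBalls γ k p t).ncard ≤ n}) ?_
  obtain ⟨t, ht⟩ := exists_aliveSet_subset (p := p)
    (W := ⋃ b ∈ psiMinus γ p, ball b ((2 : ℝ)⁻¹ ^ k)) (isOpen_biUnion fun b _ => isOpen_ball)
    fun b hb => Set.mem_biUnion hb (mem_ball_self (by positivity))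
  have hsub : aliveBalls γ k p t ⊆ (fun x => ball x ((2 : ℝ)⁻¹ ^ k)) '' psiMinus γ p := by
    rintro _ ⟨x, hx, rfl⟩
    obtain ⟨b, hb, hxb⟩ := Set.mem_iUnion₂.1 (ht hx)
    exact ⟨b, hb, IsUltrametricDist.ball_eq_of_mem hxb⟩
  exact ⟨t, (hp.1.image _).subset hsub,
    (Set.ncard_le_ncard hsub (hp.1.image _)).trans ((Set.ncard_image_le hp.1).trans hp.2.le)⟩

theorem eventually_aliveBalls_eq (hp : psiMinus γ p ∈ cardEqClass X n) (k : ℕ) :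
    ∀ᶠ q in 𝓝 p, aliveBalls γ k q (aliveStage γ n k q) =
      aliveBalls γ k p (aliveStage γ n k p) := by
  filter_upwards [Baire.eventually_agree p (aliveStage γ n k p)] with q hq
  have hle : ∀ t ≤ aliveStage γ n k p, aliveBalls γ k q t = aliveBalls γ k p t := fun t ht => by
    rw [aliveBalls, aliveBalls, aliveSet_congr fun j hj => hq j (hj.trans_le ht)]
  have hstage : aliveStage γ n k q = aliveStage γ n k p := by
    have hmem : (aliveBalls γ k q (aliveStage γ n k p)).Finite ∧
        (aliveBalls γ k q (aliveStage γ n k p)).ncard ≤ n := by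
      rw [hle _ le_rfl]
      exact aliveStage_spec hp k
    have h1 : aliveStage γ n k q ≤ aliveStage γ n k p := Nat.sInf_le hmem
    refine le_antisymm h1 (Nat.sInf_le ?_)
    have h2 := Nat.sInf_mem
      (s := {t | (aliveBalls γ k q t).Finite ∧ (aliveBalls γ k q t).ncard ≤ n}) ⟨_, hmem⟩
    change (aliveBalls γ k q (aliveStage γ n k q)).Finite ∧
      (aliveBalls γ k q (aliveStage γ n k q)).ncard ≤ n at h2
    rwa [hle _ h1] at h2
  rw [hstage, hle _ le_rfl]

theorem eventually_followedBall_eq (hp : psiMinus γ p ∈ cardEqClass X n) (k : ℕ) :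
    ∀ᶠ q in 𝓝 p, followedBall γ n q k = followedBall γ n p k := by
  induction k with
  | zero =>
    filter_upwards [eventually_aliveBalls_eq hp 0] with q hq
    simp only [followedBall, hq]
  | succ k ih =>
    filter_upwards [eventually_aliveBalls_eq hp (k + 1), ih] with q hq hk
    simp only [followedBall, hq, hk]

theorem exists_followedBall_eq_ball (hp : psiMinus γ p ∈ cardEqClass X n)
    (hne : (psiMinus γ p).Nonempty) :
    ∃ a ∈ psiMinus γ p, ∃ k₀, ∀ k ≥ k₀, followedBall γ n p k = ball a ((2 : ℝ)⁻¹ ^ k) ∧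
      ∀ x ∈ psiMinus γ p, x ∈ followedBall γ n p k → x = a := by
  obtain ⟨k₀, hk₀⟩ : ∃ k₀ : ℕ, ∀ k ≥ k₀, ∀ x ∈ psiMinus γ p, ∀ y ∈ psiMinus γ p,
      x ∈ ball y ((2 : ℝ)⁻¹ ^ k) → x = y := by
    refine eventually_atTop.1 ((Filter.eventually_all_finite hp.1).2 fun x _ =>
      (Filter.eventually_all_finite hp.1).2 fun y _ => ?_)
    by_cases hxy : x = y
    · exact Eventually.of_forall fun _ _ => hxy
    · filter_upwards [(tendsto_pow_atTop_nhds_zero_of_lt_one (r := (2 : ℝ)⁻¹) (by norm_num)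
        (by norm_num)).eventually_lt_const (dist_pos.2 hxy)] with k hk h
      exact absurd (mem_ball.1 h) (not_lt.2 hk.le)
  have hT : ∀ k ≥ k₀, aliveBalls γ k p (aliveStage γ n k p) =
      (fun x => ball x ((2 : ℝ)⁻¹ ^ k)) '' psiMinus γ p := by
    intro k hk
    have hinj : Set.InjOn (fun x => ball x ((2 : ℝ)⁻¹ ^ k)) (psiMinus γ p) := by
      intro x hx y hy hxy
      refine hk₀ k hk x hx y hy ?_
      have hxy' : ball x ((2 : ℝ)⁻¹ ^ k) = ball y ((2 : ℝ)⁻¹ ^ k) := hxy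
      exact hxy' ▸ mem_ball_self (by positivity)
    refine (Set.eq_of_subset_of_ncard_le (Set.image_mono (psiMinus_subset_aliveSet p _)) ?_
      (aliveStage_spec hp k).1).symm
    rw [hinj.ncard_image, hp.2]
    exact (aliveStage_spec hp k).2
  have hm : ∀ k ≥ k₀, ∃ a ∈ psiMinus γ p, followedBall γ n p k = ball a ((2 : ℝ)⁻¹ ^ k) := by
    intro k hk
    have := followedBall_mem (n := n) hne k
    rw [hT k hk] at this
    obtain ⟨a, ha, h⟩ := this
    exact ⟨a, ha, h.symm⟩
  obtain ⟨a, ha, hak₀⟩ := hm k₀ le_rfl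
  refine ⟨a, ha, k₀, fun k hk => ?_⟩
  have hball : followedBall γ n p k = ball a ((2 : ℝ)⁻¹ ^ k) := by
    induction k, hk using Nat.le_induction with
    | base => exact hak₀
    | succ k hk ih =>
      obtain ⟨b, hb, hbk⟩ := hm (k + 1) (hk.trans (Nat.le_succ k))
      have hsub : followedBall γ n p (k + 1) ⊆ followedBall γ n p k := by
        refine selectSubset_subset ⟨ball a ((2 : ℝ)⁻¹ ^ (k + 1)), ?_, ?_⟩
        · rw [hT (k + 1) (hk.trans (Nat.le_succ k))]
          exact ⟨a, ha, rfl⟩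
        · rw [ih]
          exact ball_subset_ball (pow_le_pow_of_le_one (by norm_num) (by norm_num)
            (Nat.le_succ k))
      have hba : b = a := by
        refine hk₀ k hk b hb a ha ?_
        rw [← ih]
        refine hsub ?_
        rw [hbk]
        exact mem_ball_self (by positivity)
      rw [hbk, hba]
  exact ⟨hball, fun x hx hxk => hk₀ k hk x hx a ha (hball ▸ hxk)⟩

/-- The points that are followed from stage `j` on, but not at the stage before. -/
def followedFrom (γ : ℕ → X) (n : ℕ) (p : Baire) (j : ℕ) : Set X :=
  {x | (∀ k ≥ j, x ∈ followedBall γ n p k) ∧ ∀ i, j = i + 1 → x ∉ followedBall γ n p i}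

theorem exists_mem_followedFrom_iff (hp : psiMinus γ p ∈ cardEqClass X n)
    (hne : (psiMinus γ p).Nonempty) :
    ∃ a ∈ psiMinus γ p, ∃ j₀, ∀ x ∈ psiMinus γ p, ∀ j,
      x ∈ followedFrom γ n p j ↔ x = a ∧ j = j₀ := by
  classical
  obtain ⟨a, ha, k₀, hk₀⟩ := exists_followedBall_eq_ball hp hne
  have hex : ∃ j, ∀ k ≥ j, a ∈ followedBall γ n p k := ⟨k₀, fun k hk => by
    rw [(hk₀ k hk).1]
    exact mem_ball_self (by positivity)⟩
  refine ⟨a, ha, Nat.find hex, fun x hx j => ⟨fun hxj => ?_, ?_⟩⟩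
  · obtain rfl : x = a := (hk₀ (max j k₀) (le_max_right _ _)).2 x hx (hxj.1 _ (le_max_left _ _))
    refine ⟨rfl, le_antisymm (not_lt.1 fun hlt => ?_) (Nat.find_min' hex hxj.1)⟩
    obtain ⟨i, rfl⟩ := Nat.exists_eq_succ_of_ne_zero (Nat.ne_of_gt (Nat.zero_lt_of_lt hlt))
    exact hxj.2 i rfl (Nat.find_spec hex i (Nat.lt_succ_iff.1 hlt))
  · rintro ⟨rfl, rfl⟩
    refine ⟨Nat.find_spec hex, fun i hi hxi => ?_⟩
    refine Nat.find_min hex (m := i) (by omega) fun k hk => ?_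
    rcases hk.eq_or_lt with rfl | hlt
    · exact hxi
    · exact Nat.find_spec hex k (by omega)

/-- The set `A × {0}` together with a copy of the followed point of `A`, tagged by the stage from
which on it is followed. -/
def doubledSet (γ : ℕ → X) (n : ℕ) (p : Baire) : Set (X × (ℕ → Bool)) :=
  {w | w.1 ∈ psiMinus γ p ∧ (∀ i j, w.2 i = true → w.2 j = true → i = j) ∧
    ∀ j, w.2 j = true → w.1 ∈ followedFrom γ n p j}

theorem doubledSet_mem_cardEqClass (hp : psiMinus γ p ∈ cardEqClass X n)
    (hne : (psiMinus γ p).Nonempty) :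
    doubledSet γ n p ∈ cardEqClass (X × (ℕ → Bool)) (n + 1) := by
  obtain ⟨a, ha, j₀, hj₀⟩ := exists_mem_followedFrom_iff hp hne
  set tag : ℕ → Bool := fun i => decide (i = j₀) with htag
  have heq : doubledSet γ n p =
      insert (a, tag) ((fun x => (x, fun _ => false)) '' psiMinus γ p) := by
    ext ⟨x, y⟩
    simp only [doubledSet, Set.mem_ofPred_eq, Set.mem_insert_iff, Set.mem_image, Prod.mk.injEq]
    constructor
    · rintro ⟨hx, hy, hxy⟩
      by_cases h : ∃ j, y j = true
      · obtain ⟨j, hj⟩ := h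
        obtain ⟨rfl, rfl⟩ := (hj₀ x hx j).1 (hxy j hj)
        refine Or.inl ⟨rfl, funext fun i => ?_⟩
        by_cases hi : i = j
        · simp [htag, hi, hj]
        · have : y i ≠ true := fun h => hi (hy i j h hj)
          simpa [htag, hi] using this
      · push Not at h
        exact Or.inr ⟨x, hx, rfl, funext fun i => by simpa using (h i)⟩
    · rintro (⟨rfl, rfl⟩ | ⟨x', hx', rfl, rfl⟩)
      · refine ⟨ha, fun i j hi hj => ?_, fun j hj => ?_⟩
        · simp only [htag, decide_eq_true_eq] at hi hj
          rw [hi, hj]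
        · simp only [htag, decide_eq_true_eq] at hj
          exact (hj₀ x ha j).2 ⟨rfl, hj⟩
      · exact ⟨hx', by simp, by simp⟩
  have hinj : Function.Injective (fun x : X => (x, fun _ : ℕ => false)) := fun x x' h =>
    congrArg Prod.fst h
  have hnot : (a, tag) ∉ (fun x => (x, fun _ : ℕ => false)) '' psiMinus γ p := by
    rintro ⟨x, -, hx⟩
    have := congrFun (congrArg Prod.snd hx) j₀
    simp [htag] at this
  rw [heq]
  refine ⟨(hp.1.image _).insert _, ?_⟩
  rw [Set.ncard_insert_of_notMem hnot (hp.1.image _), Set.ncard_image_of_injective _ hinj, hp.2]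

theorem eventually_notMem_doubledSet (hp : psiMinus γ p ∈ cardEqClass X n)
    (hne : (psiMinus γ p).Nonempty) {w : X × (ℕ → Bool)} (hw : w ∉ doubledSet γ n p) :
    ∀ᶠ v in 𝓝 p ×ˢ 𝓝 w, v.2 ∉ doubledSet γ n v.1 := by
  have htag : ∀ i, w.2 i = true → ∀ᶠ v in 𝓝 p ×ˢ 𝓝 w, v.2.2 i = true := by
    intro i hi
    have h : ∀ᶠ b in 𝓝 (w.2 i), b = true := by simp [nhds_discrete, hi]
    exact tendsto_snd.eventually
      (((continuous_apply i).comp continuous_snd).continuousAt.eventually h)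
  have hfst : ∀ {U : Set X}, IsOpen U → w.1 ∈ U → ∀ᶠ v in 𝓝 p ×ˢ 𝓝 w, v.2.1 ∈ U :=
    fun hU hwU => tendsto_snd.eventually
      (continuous_fst.continuousAt.eventually (hU.mem_nhds hwU))
  have hfollow : ∀ k, ∀ᶠ v : Baire × (X × (ℕ → Bool)) in 𝓝 p ×ˢ 𝓝 w,
      followedBall γ n v.1 k = followedBall γ n p k := fun k =>
    tendsto_fst.eventually (eventually_followedBall_eq hp k)
  by_cases h1 : w.1 ∈ psiMinus γ p
  · by_cases h2 : ∀ i j, w.2 i = true → w.2 j = true → i = j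
    · obtain ⟨j, hj, hjw⟩ : ∃ j, w.2 j = true ∧ w.1 ∉ followedFrom γ n p j := by
        by_contra! h
        exact hw ⟨h1, h2, h⟩
      rw [followedFrom, Set.mem_ofPred_eq, not_and_or] at hjw
      push Not at hjw
      rcases hjw with ⟨k, hk, hwk⟩ | ⟨i, hi, hwi⟩
      · filter_upwards [htag j hj, hfollow k,
          hfst (isClopen_followedBall hne k).compl.isOpen hwk] with v hv1 hv2 hv3 hv
        exact hv3 (hv2 ▸ (hv.2.2 j hv1).1 k hk)
      · filter_upwards [htag j hj, hfollow i,
          hfst (isClopen_followedBall hne i).isOpen hwi] with v hv1 hv2 hv3 hv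
        exact (hv.2.2 j hv1).2 i hi (hv2 ▸ hv3)
    · push Not at h2
      obtain ⟨i, j, hi, hj, hij⟩ := h2
      filter_upwards [htag i hi, htag j hj] with v hvi hvj hv
      exact hij (hv.2.1 i j hvi hvj)
  · obtain ⟨i, hi⟩ : ∃ i, w.1 ∈ ballCode γ (p i) := by
      by_contra! h
      exact h1 h
    have hpi : ∀ᶠ v : Baire × (X × (ℕ → Bool)) in 𝓝 p ×ˢ 𝓝 w, ∀ j < i + 1, v.1 j = p j :=
      tendsto_fst.eventually (Baire.eventually_agree p (i + 1))
    filter_upwards [hpi, hfst (isOpen_ballCode (p i)) hi] with v hv1 hv2 hv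
    refine hv.1 i ?_
    rwa [hv1 i (Nat.lt_succ_self i)]

theorem wRed_choice_cardEq_succ [Nonempty X] (e : X ≃ₜ X × (ℕ → Bool)) (hγ : DenseRange γ)
    (hn : 1 ≤ n) :
    WRed (closedRep γ) (pointRep γ) (closedRep γ) (pointRep γ)
        (choiceFn (cardEqClass X n)) (choiceFn (cardEqClass X (n + 1))) := by
  have hne : ∀ p, psiMinus γ p ∈ cardEqClass X n → (psiMinus γ p).Nonempty := fun p hp =>
    Set.nonempty_of_ncard_ne_zero (by have := hp.2; omega)
  refine wRed_choice_of_closedGraph hγ (fun p => e ⁻¹' doubledSet γ n p)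
    (f := fun z => (e z).1) (continuous_fst.comp e.continuous) (fun p hp x hx => ?_)
    (fun p hp _ => ?_) fun p _ z hz => hz.1
  · have h := eventually_notMem_doubledSet hp (hne p hp) hx
    have ht : Tendsto (Prod.map id e) (𝓝[{p | psiMinus γ p ∈ cardEqClass X n}] p ×ˢ 𝓝 x)
        (𝓝 p ×ˢ 𝓝 (e x)) :=
      (tendsto_id.mono_left nhdsWithin_le_nhds).prodMap e.continuous.continuousAt
    exact ht.eventually h
  · have hcard := doubledSet_mem_cardEqClass hp (hne p hp)
    have hncard : (e ⁻¹' doubledSet γ n p).ncard = n + 1 := by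
      rw [← Set.ncard_image_of_injective _ e.injective,
        Set.image_preimage_eq _ e.surjective, hcard.2]
    exact ⟨⟨hcard.1.preimage e.injective.injOn, hncard⟩,
      Set.nonempty_of_ncard_ne_zero (by omega)⟩

end Followed

end General

/-! Cantor space. -/

theorem cantor_infinite_of_isOpen {U : Set (ℕ → Bool)} (hU : IsOpen U) (hne : U.Nonempty) :
    U.Infinite := by
  obtain ⟨x, hx⟩ := hne
  obtain ⟨I, u, hu, hsub⟩ := isOpen_pi_iff.1 hU x hx
  let s := I.sup id + 1
  refine Set.infinite_of_injective_forall_mem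
    (f := fun (m : ℕ) (i : ℕ) => if i < s then x i else decide (i = s + m)) ?_ fun m => hsub ?_
  · intro m m' h
    have := congrFun h (s + m)
    simpa using this
  · intro i hi
    have his : i < s := Nat.lt_succ_of_le (Finset.le_sup (f := id) hi)
    simp only [his, if_true]
    exact (hu i hi).2

instance cantor_isUltrametricDist : IsUltrametricDist (ℕ → Bool) := ⟨PiNat.dist_triangle_nonarch⟩

/-- Cantor space is homeomorphic to its square. -/
def cantorHomeomorphSquare : (ℕ → Bool) ≃ₜ (ℕ → Bool) × (ℕ → Bool) :=
  (Homeomorph.piCongrLeft (Y := fun _ => Bool) Equiv.natSumNatEquivNat).symm.trans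
    Homeomorph.sumArrowHomeomorphProdArrow

end Choice

/-- For every n ≥ 1, C_{{0,1}^ℕ,#=n} <_W C_{{0,1}^ℕ,#=n+1}. -/
theorem stmt2 (n : ℕ) (hn : 1 ≤ n) (γ : ℕ → (ℕ → Bool)) (hγ : DenseRange γ) :
    WRed (closedRep γ) (pointRep γ) (closedRep γ) (pointRep γ)
        (choiceFn (cardEqClass (ℕ → Bool) n))
        (choiceFn (cardEqClass (ℕ → Bool) (n + 1)))
    ∧ ¬ WRed (closedRep γ) (pointRep γ) (closedRep γ) (pointRep γ)
        (choiceFn (cardEqClass (ℕ → Bool) (n + 1)))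
        (choiceFn (cardEqClass (ℕ → Bool) n)) := by
  exact ⟨wRed_choice_cardEq_succ cantorHomeomorphSquare hγ hn,
    not_wRed_choice_cardEq_succ hγ (fun _ => cantor_infinite_of_isOpen) hn⟩
end

section
/- For every n ≥ 2 and every m ∈ ℕ, choice for n-point subsets of Cantor space is not topologically Weihrauch reducible to closed choice on the finite discrete space {0,…,m}: C_{{0,1}^ℕ,#=n} ≰_W C_{{0,…,m}}. -/
lemma exists_finite_ncard_subset_ball (n : ℕ) (b : ℕ → Bool) {r : ℝ} (hr : 0 < r) :
    ∃ B : Set (ℕ → Bool), B.Finite ∧ B.ncard = n ∧ B ⊆ Metric.ball b r := by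
  obtain ⟨N, hN⟩ := exists_pow_lt_of_lt_one hr (by norm_num : (1 / 2 : ℝ) < 1)
  let c : ℕ → (ℕ → Bool) := fun k => Function.update b (N + k) (!b (N + k))
  have hc : Function.Injective c := by
    intro k l h
    by_contra hkl
    have h1 := congrFun h (N + k)
    have h2 : N + k ≠ N + l := by omega
    simp [c, Function.update_of_ne h2] at h1
  have hball : Set.range c ⊆ Metric.ball b r := by
    rintro _ ⟨k, rfl⟩
    refine lt_of_le_of_lt ((PiNat.mem_cylinder_iff_dist_le (n := N)).1 ?_) hN
    intro i hi
    exact Function.update_of_ne (by omega) _ _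
  obtain ⟨B, hB, hBfin, hBn⟩ := (Set.infinite_range_of_injective hc).exists_subset_ncard_eq n
  exact ⟨B, hBfin, hBn, hB.trans hball⟩

lemma exists_ball_disjoint_ballCode (γ : ℕ → (ℕ → Bool)) (k : ℕ) {b : ℕ → Bool}
    (hb : b ∉ ballCode γ k) : ∃ r > 0, ∀ x ∈ Metric.ball b r, x ∉ ballCode γ k := by
  by_cases hk : ratCode k.unpair.2 ≤ 0
  · refine ⟨1, one_pos, fun x _ hx => ?_⟩
    exact absurd (dist_nonneg.trans_lt (Metric.mem_ball.1 hx)) hk.not_gt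
  · refine ⟨_, not_le.1 hk, fun x hx hx' => hb ?_⟩
    refine (PiNat.dist_triangle_nonarch b x _).trans_lt (max_lt ?_ hx')
    rw [PiNat.dist_comm]
    exact hx

lemma exists_ball_disjoint_prefix (γ : ℕ → (ℕ → Bool)) {p : Baire} {b : ℕ → Bool}
    (hb : b ∈ psiMinus γ p) (L : ℕ) :
    ∃ r > 0, ∀ x ∈ Metric.ball b r, ∀ i < L, x ∉ ballCode γ (p i) := by
  induction L with
  | zero => exact ⟨1, one_pos, by simp⟩
  | succ L ih =>
    obtain ⟨r, hr, h⟩ := ih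
    obtain ⟨s, hs, h'⟩ := exists_ball_disjoint_ballCode γ (p L) (hb L)
    refine ⟨min r s, lt_min hr hs, fun x hx i hi => ?_⟩
    rcases Nat.lt_succ_iff_lt_or_eq.1 hi with hi | rfl
    · exact h x (Metric.ball_subset_ball (min_le_left _ _) hx) i hi
    · exact h' x (Metric.ball_subset_ball (min_le_right _ _) hx)

/-- A closed set avoiding the first `L` balls enumerated by `p` has a name sharing with `p` its
first `L` entries. -/
lemma exists_name_extending_prefix {X : Type*} [MetricSpace X] {γ : ℕ → X} (hγ : DenseRange γ)
    (p : Baire) (L : ℕ) {B : Set X} (hB : IsClosed B)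
    (hp : ∀ x ∈ B, ∀ i < L, x ∉ ballCode γ (p i)) :
    ∃ q : Baire, psiMinus γ q = B ∧ ∀ i < L, q i = p i := by
  classical
  refine ⟨fun i => if i < L then p i else
    if Disjoint (ballCode γ (i - L)) B then i - L else 0, ?_, fun i hi => by simp [hi]⟩
  ext x
  constructor
  · intro hx
    by_contra hxB
    obtain ⟨ε, hε, hball⟩ := Metric.isOpen_iff.1 hB.isOpen_compl x hxB
    obtain ⟨d, hd⟩ := exists_nat_one_div_lt (half_pos hε)
    have hd0 : (0 : ℝ) < 1 / ((d : ℝ) + 1) := by positivity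
    obtain ⟨k, hk⟩ := hγ.exists_dist_lt x hd0
    let c := Nat.pair k (Nat.pair 1 d)
    have hc : ballCode γ c = Metric.ball (γ k) (1 / ((d : ℝ) + 1)) := by
      simp [ballCode, ratCode, c]
    have hdisj : Disjoint (ballCode γ c) B := by
      rw [hc, Set.disjoint_left]
      intro y hy
      refine hball ?_
      have h1 := dist_triangle y (γ k) x
      rw [dist_comm (γ k) x] at h1
      have h2 := Metric.mem_ball.1 hy
      rw [Metric.mem_ball]
      linarith
    have h := hx (L + c)
    simp only [show ¬ L + c < L by omega, if_false, Nat.add_sub_cancel_left, if_pos hdisj]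
      at h
    rw [hc] at h
    exact h hk
  · intro hx i
    by_cases hi : i < L
    · simpa [hi] using hp x hx i hi
    · by_cases hd : Disjoint (ballCode γ (i - L)) B
      · simpa [hi, hd] using fun h => Set.disjoint_left.1 hd h hx
      · simp only [if_neg hi, if_neg hd]
        simp [ballCode, ratCode]

lemma exists_name_near_point {γ : ℕ → (ℕ → Bool)} (hγ : DenseRange γ) (n : ℕ) {p : Baire}
    {b : ℕ → Bool} (hb : b ∈ psiMinus γ p) {r : ℝ} (hr : 0 < r) (L : ℕ) :
    ∃ q : Baire, psiMinus γ q ∈ cardEqClass (ℕ → Bool) n ∧ psiMinus γ q ⊆ Metric.ball b r ∧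
      ∀ i < L, q i = p i := by
  obtain ⟨s, hs, h⟩ := exists_ball_disjoint_prefix γ hb L
  obtain ⟨B, hfin, hn, hB⟩ := exists_finite_ncard_subset_ball n b (lt_min hr hs)
  obtain ⟨q, rfl, hq⟩ := exists_name_extending_prefix hγ p L hfin.isClosed fun x hx =>
    h x (Metric.ball_subset_ball (min_le_right _ _) (hB hx))
  exact ⟨q, ⟨hfin, hn⟩, hB.trans (Metric.ball_subset_ball (min_le_left _ _)), hq⟩

/-- No continuous function selects points from `n`-point sets along a sequence of names that
approximates `p`, when the sets stay close to a point other than the one selected at `p`. -/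
lemma not_tendsto_of_names_near {X : Type*} [MetricSpace X] {γ : ℕ → X} {u : ℕ → Baire}
    {v : Baire} (h : Filter.Tendsto u Filter.atTop (nhds v)) {a b : X} (hab : a ≠ b)
    (ha : (pointRep γ).R v a) {y : ℕ → X}
    (hy : ∀ᶠ L in Filter.atTop, (pointRep γ).R (u L) (y L))
    (hyb : ∀ᶠ L in Filter.atTop, y L ∈ Metric.ball b (dist a b / 2)) : False := by
  have hd : 0 < dist a b / 4 := by have := dist_pos.2 hab; linarith
  obtain ⟨j, hj⟩ := exists_pow_lt_of_lt_one hd (by norm_num : (2 : ℝ)⁻¹ < 1)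
  have h1 : ∀ᶠ L in Filter.atTop, u L j = v j := by
    have := tendsto_pi_nhds.1 h j
    rwa [nhds_discrete, Filter.tendsto_pure] at this
  obtain ⟨L, h1, h2, h3⟩ := (h1.and (hy.and hyb)).exists
  have h4 := h2 j
  have h5 := ha j
  rw [h1] at h4
  rw [Metric.mem_ball] at h3
  have h6 := dist_triangle_right a (y L) (γ (v j))
  have h7 := dist_triangle a (y L) b
  linarith

/-- The subset of `Fin k` named by `q`. -/
def finSetOfName (k : ℕ) (q : Baire) : Set (Fin k) := {i | ∀ t, q t ≠ (i : ℕ) + 1}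

/-- Some realizer of finite closed choice returns a given admissible answer at `q`. -/
lemma exists_finChoice_realizer {k : ℕ} (q : Baire) (i : Fin k)
    (hi : (finSetOfName k q).Nonempty → i ∈ finSetOfName k q) :
    ∃ G : Baire → Baire, Realizes (finSetRep k) (finPointRep k) (choiceFn Set.univ) G ∧
      G q = fun _ => (i : ℕ) := by
  classical
  have : ∀ q' : Baire, ∃ j : Fin k,
      ((finSetOfName k q').Nonempty → j ∈ finSetOfName k q') ∧ (q' = q → j = i) := by
    intro q'
    by_cases hq : q' = q
    · subst hq
      exact ⟨i, hi, fun _ => rfl⟩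
    · by_cases hne : (finSetOfName k q').Nonempty
      · exact ⟨hne.some, fun _ => hne.some_mem, fun h => absurd h hq⟩
      · exact ⟨i, fun h => absurd h hne, fun h => absurd h hq⟩
  choose g hg hgq using this
  refine ⟨fun q' _ => g q', ?_, by simp [hgq q rfl]⟩
  rintro q' A rfl ⟨x, hx⟩
  exact ⟨g q', ⟨Set.mem_univ _, hg q' ⟨x, hx.2⟩⟩, rfl⟩

lemma continuous_pairB_left (q : Baire) : Continuous fun p : Baire => pairB p q := by
  refine continuous_pi fun n => ?_
  by_cases h : n % 2 = 0
  · simpa [pairB, h] using continuous_apply (n / 2)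
  · simpa [pairB, h] using continuous_const

lemma eventually_finSetOfName_subset {k : ℕ} {u : ℕ → Baire} {v : Baire}
    (h : Filter.Tendsto u Filter.atTop (nhds v)) :
    ∀ᶠ L in Filter.atTop, finSetOfName k (u L) ⊆ finSetOfName k v := by
  have : ∀ i : Fin k, ∀ᶠ L in Filter.atTop, i ∈ finSetOfName k (u L) → i ∈ finSetOfName k v := by
    intro i
    by_cases hi : i ∈ finSetOfName k v
    · exact Filter.Eventually.of_forall fun _ _ => hi
    · simp only [finSetOfName, Set.mem_ofPred_eq, not_forall, not_not] at hi
      obtain ⟨t, ht⟩ := hi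
      have h1 := tendsto_pi_nhds.1 h t
      rw [nhds_discrete, Filter.tendsto_pure] at h1
      filter_upwards [h1] with L hL hiL
      exact absurd (hL.trans ht) (hiL t)
  exact (Filter.eventually_all.2 this).mono fun L hL i => hL i

/-- For n ≥ 2 and m ∈ ℕ, C_{{0,1}^ℕ,#=n} ≰_W C_{{0,…,m}}. -/
theorem stmt5 (n m : ℕ) (hn : 2 ≤ n) (γ : ℕ → (ℕ → Bool)) (hγ : DenseRange γ) :
    ¬ WRed (closedRep γ) (pointRep γ) (finSetRep (m + 1)) (finPointRep (m + 1))
        (choiceFn (cardEqClass (ℕ → Bool) n)) (choiceFn Set.univ) := by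
  rintro ⟨H, K, dH, dK, hH, hK, hred⟩
  let N : Set Baire := {p | psiMinus γ p ∈ cardEqClass (ℕ → Bool) n}
  let S : Baire → Set (Fin (m + 1)) := fun p => finSetOfName (m + 1) (H p)
  have key : ∀ p ∈ N, ∀ i : Fin (m + 1), ((S p).Nonempty → i ∈ S p) →
      p ∈ dH ∧ pairB p (fun _ => (i : ℕ)) ∈ dK ∧
        ∃ y ∈ psiMinus γ p, (pointRep γ).R (K (pairB p fun _ => (i : ℕ))) y := by
    intro p hp i hi
    obtain ⟨G, hG, hGp⟩ := exists_finChoice_realizer (H p) i hi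
    have hne : (psiMinus γ p).Nonempty :=
      (Set.ncard_pos hp.1).1 (by rw [hp.2]; omega)
    obtain ⟨h1, h2, y, hy, hyK⟩ :=
      hred G hG p (psiMinus γ p) rfl (hne.mono fun x hx => ⟨hp, hx⟩)
    rw [hGp] at h2 hyK
    exact ⟨h1, h2, y, hy.2, hyK⟩
  have hN : N.Nonempty := by
    obtain ⟨B, hfin, hBn, -⟩ := exists_finite_ncard_subset_ball n (fun _ => false) one_pos
    obtain ⟨q, rfl, -⟩ := exists_name_extending_prefix hγ 0 0 hfin.isClosed (by simp)
    exact ⟨q, hfin, hBn⟩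
  -- On names of `n`-point sets near a minimizer of `#(S p)`, the set `S` is constant.
  obtain ⟨p, hpN, hmin⟩ := (measure fun p => (S p).ncard).wf.has_min N hN
  obtain ⟨i, hi⟩ : ∃ i, (S p).Nonempty → i ∈ S p := by
    by_cases h : (S p).Nonempty
    · exact ⟨h.some, fun _ => h.some_mem⟩
    · exact ⟨0, fun h' => absurd h' h⟩
  obtain ⟨hpH, hpK, a, ha, haK⟩ := key p hpN i hi
  obtain ⟨b, hb, hba⟩ := Set.exists_ne_of_one_lt_ncard (by rw [hpN.2]; omega) a
  have hr : 0 < dist a b / 2 := half_pos (dist_pos.2 hba.symm)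
  choose q hqN hqb hqp using exists_name_near_point hγ n hb hr
  have hq : Filter.Tendsto q Filter.atTop (nhds p) := by
    refine tendsto_pi_nhds.2 fun j => tendsto_const_nhds.congr' ?_
    filter_upwards [Filter.eventually_gt_atTop j] with L hL
    exact (hqp L j hL).symm
  have hqH : Filter.Tendsto (fun L => H (q L)) Filter.atTop (nhds (H p)) :=
    (hH p hpH).tendsto.comp (tendsto_nhdsWithin_iff.2
      ⟨hq, Filter.Eventually.of_forall fun L => by
        by_cases h : (S (q L)).Nonempty
        · exact (key _ (hqN L) h.some fun _ => h.some_mem).1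
        · exact (key _ (hqN L) 0 fun h' => absurd h' h).1⟩)
  have hS : ∀ᶠ L in Filter.atTop, S (q L) = S p :=
    (eventually_finSetOfName_subset hqH).mono fun L hL =>
      Set.eq_of_subset_of_ncard_le hL (not_lt.1 (hmin (q L) (hqN L)))
  have hval : ∀ᶠ L in Filter.atTop, pairB (q L) (fun _ => (i : ℕ)) ∈ dK ∧
      ∃ y ∈ psiMinus γ (q L), (pointRep γ).R (K (pairB (q L) fun _ => (i : ℕ))) y :=
    hS.mono fun L hL => (key (q L) (hqN L) i (by rwa [hL])).2
  have hqK : Filter.Tendsto (fun L => K (pairB (q L) fun _ => (i : ℕ))) Filter.atTop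
      (nhds (K (pairB p fun _ => (i : ℕ)))) :=
    (hK _ hpK).tendsto.comp (tendsto_nhdsWithin_iff.2
      ⟨((continuous_pairB_left _).tendsto p).comp hq, hval.mono fun _ h => h.1⟩)
  have hchoice : ∀ L, ∃ y, pairB (q L) (fun _ => (i : ℕ)) ∈ dK ∧
      (∃ y ∈ psiMinus γ (q L), (pointRep γ).R (K (pairB (q L) fun _ => (i : ℕ))) y) →
      y ∈ psiMinus γ (q L) ∧ (pointRep γ).R (K (pairB (q L) fun _ => (i : ℕ))) y := by
    intro L
    by_cases h : ∃ y ∈ psiMinus γ (q L), (pointRep γ).R (K (pairB (q L) fun _ => (i : ℕ))) y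
    · exact ⟨h.choose, fun _ => h.choose_spec⟩
    · exact ⟨a, fun h' => absurd h'.2 h⟩
  choose y hy using hchoice
  exact not_tendsto_of_names_near hqK hba.symm haK
    (hval.mono fun L h => (hy L h).2) (hval.mono fun L h => hqb L (hy L h).1)
end
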